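/- Let n ≥ 1, let Ω ⊂ ℝ^n be open, let f ∈ BV(Ω), and let δ > 0. Then there exists h ∈ SBV(Ω) such that ‖h − f‖_{L^∞(Ω)} < δ, |D^j h|(Ω) ≤ |D^j f|(Ω) + 2δ, and |D^a h|(Ω) ≤ |D^a f|(Ω) + |D^c f|(Ω) + 3δ. -/

import Mathlib

open MeasureTheory Filter Topology Metric
open scoped ENNReal RealInnerProductSpace Classical

noncomputable section

/-- An open cube in `ℝⁿ` with side length `ε` and arbitrary orientation. -/
def IsCube (n : ℕ) (ε : ℝ) (Q : Set (EuclideanSpace ℝ (Fin n))) : Prop :=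
  ∃ (T : EuclideanSpace ℝ (Fin n) ≃ₗᵢ[ℝ] EuclideanSpace ℝ (Fin n))
    (x : EuclideanSpace ℝ (Fin n)),
    Q = (fun y => x + T y) '' {y : EuclideanSpace ℝ (Fin n) | ∀ i, |y i| < ε / 2}

/-- The BMO-type functional `κ_ε(f, Ω)`. -/
def kappa (n : ℕ) (ε : ℝ) (f : EuclideanSpace ℝ (Fin n) → ℝ)
    (Ω : Set (EuclideanSpace ℝ (Fin n))) : ℝ≥0∞ :=
  ENNReal.ofReal (ε ^ (n - 1)) *
    ⨆ (F : Set (Set (EuclideanSpace ℝ (Fin n))))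
      (_ : ∀ Q ∈ F, IsCube n ε Q ∧ Q ⊆ Ω) (_ : F.Pairwise Disjoint),
      ∑' Q : F, ENNReal.ofReal
        (⨍ x in (Q : Set (EuclideanSpace ℝ (Fin n))),
          |f x - ⨍ y in (Q : Set (EuclideanSpace ℝ (Fin n))), f y ∂volume| ∂volume)

/-- The divergence of a vector field on `ℝⁿ`. -/
def vdiv (n : ℕ) (Φ : EuclideanSpace ℝ (Fin n) → EuclideanSpace ℝ (Fin n))
    (x : EuclideanSpace ℝ (Fin n)) : ℝ :=
  ∑ i : Fin n, fderiv ℝ Φ x (EuclideanSpace.single i 1) i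

/-- The variation `Var(f, Ω)`. -/
def variation (n : ℕ) (f : EuclideanSpace ℝ (Fin n) → ℝ)
    (Ω : Set (EuclideanSpace ℝ (Fin n))) : ℝ≥0∞ :=
  ⨆ (Φ : EuclideanSpace ℝ (Fin n) → EuclideanSpace ℝ (Fin n))
    (_ : ContDiff ℝ 1 Φ) (_ : HasCompactSupport Φ) (_ : tsupport Φ ⊆ Ω)
    (_ : ∀ x, ‖Φ x‖ ≤ 1),
    ENNReal.ofReal (∫ x in Ω, f x * vdiv n Φ x)

/-- The approximate jump set `J_f`. -/
def jumpSet (n : ℕ) (f : EuclideanSpace ℝ (Fin n) → ℝ) : Set (EuclideanSpace ℝ (Fin n)) :=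
  {x | ∃ ν : EuclideanSpace ℝ (Fin n), ‖ν‖ = 1 ∧ ∃ a b : ℝ, a ≠ b ∧
    Tendsto (fun r : ℝ =>
        ⨍ y in {y ∈ ball x r | 0 < ⟪y - x, ν⟫}, |f y - a| ∂volume)
      (𝓝[>] 0) (𝓝 0) ∧
    Tendsto (fun r : ℝ =>
        ⨍ y in {y ∈ ball x r | ⟪y - x, ν⟫ < 0}, |f y - b| ∂volume)
      (𝓝[>] 0) (𝓝 0)}

/-- The approximate discontinuity set `S_f` (the set of non-Lebesgue points). -/
def approxDiscontSet (n : ℕ) (f : EuclideanSpace ℝ (Fin n) → ℝ) :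
    Set (EuclideanSpace ℝ (Fin n)) :=
  {x | ¬ ∃ c : ℝ,
    Tendsto (fun r : ℝ => ⨍ y in ball x r, |f y - c| ∂volume) (𝓝[>] 0) (𝓝 0)}

/-- `(μ, σ)` is the polar decomposition `Df = σ |Df|` of the gradient measure of `f` on `Ω`:
`μ` plays the role of the total variation measure `|Df|` and `σ` of the polar vector field. -/
def IsVariationPair (n : ℕ) (f : EuclideanSpace ℝ (Fin n) → ℝ)
    (Ω : Set (EuclideanSpace ℝ (Fin n))) (μ : Measure (EuclideanSpace ℝ (Fin n)))
    (σ : EuclideanSpace ℝ (Fin n) → EuclideanSpace ℝ (Fin n)) : Prop :=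
  IsFiniteMeasure μ ∧ μ Ωᶜ = 0 ∧ AEStronglyMeasurable σ μ ∧ (∀ᵐ x ∂μ, ‖σ x‖ = 1) ∧
  ∀ Φ : EuclideanSpace ℝ (Fin n) → EuclideanSpace ℝ (Fin n),
    ContDiff ℝ 1 Φ → HasCompactSupport Φ → tsupport Φ ⊆ Ω →
    ∫ x in Ω, f x * vdiv n Φ x = - ∫ x, ⟪Φ x, σ x⟫ ∂μ

/-- `|D^a f|(Ω)`, the total variation of the absolutely continuous part of `Df`,
with the convention that it is `∞` if `f` is not of bounded variation in `Ω`. -/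
def absVar (n : ℕ) (f : EuclideanSpace ℝ (Fin n) → ℝ)
    (Ω : Set (EuclideanSpace ℝ (Fin n))) : ℝ≥0∞ :=
  if h : ∃ p : Measure (EuclideanSpace ℝ (Fin n)) ×
      (EuclideanSpace ℝ (Fin n) → EuclideanSpace ℝ (Fin n)),
      IsVariationPair n f Ω p.1 p.2 then
    volume.withDensity ((h.choose.1).rnDeriv volume) Ω
  else ⊤

/-- `|D^c f|(Ω)`, the total variation of the Cantor part of `Df`,
with the convention that it is `∞` if `f` is not of bounded variation in `Ω`. -/
def cantorVar (n : ℕ) (f : EuclideanSpace ℝ (Fin n) → ℝ)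
    (Ω : Set (EuclideanSpace ℝ (Fin n))) : ℝ≥0∞ :=
  if h : ∃ p : Measure (EuclideanSpace ℝ (Fin n)) ×
      (EuclideanSpace ℝ (Fin n) → EuclideanSpace ℝ (Fin n)),
      IsVariationPair n f Ω p.1 p.2 then
    (h.choose.1.singularPart volume) (Ω \ approxDiscontSet n f)
  else ⊤

/-- `|D^j f|(Ω)`, the total variation of the jump part of `Df`,
with the convention that it is `∞` if `f` is not of bounded variation in `Ω`. -/
def jumpVar (n : ℕ) (f : EuclideanSpace ℝ (Fin n) → ℝ)
    (Ω : Set (EuclideanSpace ℝ (Fin n))) : ℝ≥0∞ :=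
  if h : ∃ p : Measure (EuclideanSpace ℝ (Fin n)) ×
      (EuclideanSpace ℝ (Fin n) → EuclideanSpace ℝ (Fin n)),
      IsVariationPair n f Ω p.1 p.2 then
    (h.choose.1.singularPart volume) (jumpSet n f ∩ Ω)
  else ⊤

/-- `g` is the weak (distributional) gradient of `u` on `Ω`. -/
def HasWeakGradientOn (n : ℕ) (u : EuclideanSpace ℝ (Fin n) → ℝ)
    (g : EuclideanSpace ℝ (Fin n) → EuclideanSpace ℝ (Fin n))
    (Ω : Set (EuclideanSpace ℝ (Fin n))) : Prop :=
  ∀ φ : EuclideanSpace ℝ (Fin n) → ℝ,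
    ContDiff ℝ 1 φ → HasCompactSupport φ → tsupport φ ⊆ Ω →
    ∀ k : Fin n,
      ∫ x in Ω, u x * fderiv ℝ φ x (EuclideanSpace.single k 1) =
        - ∫ x in Ω, φ x * g x k

/-- `f ∈ BV(Ω)`: `f` is integrable on `Ω` and has finite variation in `Ω`. -/
def IsBVOn (n : ℕ) (f : EuclideanSpace ℝ (Fin n) → ℝ)
    (Ω : Set (EuclideanSpace ℝ (Fin n))) : Prop :=
  IntegrableOn f Ω volume ∧ variation n f Ω < ⊤

/-- `f ∈ SBV(Ω)`: `f ∈ BV(Ω)` and the Cantor part of `Df` vanishes. -/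
def IsSBVOn (n : ℕ) (f : EuclideanSpace ℝ (Fin n) → ℝ)
    (Ω : Set (EuclideanSpace ℝ (Fin n))) : Prop :=
  IsBVOn n f Ω ∧ cantorVar n f Ω = 0

section SBVApproximation

variable {n : ℕ}

/-- The Euclidean space `ℝⁿ`. -/
abbrev Euc (n : ℕ) : Type := EuclideanSpace ℝ (Fin n)

/-- The radius of the `j`-th mollifier. -/
def mollRadius (j : ℕ) : ℝ := 1 / ((j : ℝ) + 1)

lemma mollRadius_pos (j : ℕ) : 0 < mollRadius j := Nat.one_div_pos_of_nat

lemma tendsto_mollRadius : Tendsto mollRadius atTop (𝓝 0) :=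
  tendsto_one_div_add_atTop_nhds_zero_nat

/-- The bump function underlying the `j`-th mollifier. -/
def mollBump (n j : ℕ) : ContDiffBump (0 : Euc n) where
  rIn := mollRadius j / 2
  rOut := mollRadius j
  rIn_pos := half_pos (mollRadius_pos j)
  rIn_lt_rOut := half_lt_self (mollRadius_pos j)

/-- The `j`-th standard mollifier. -/
def moll (n j : ℕ) : Euc n → ℝ := (mollBump n j).normed volume

lemma moll_nonneg (j : ℕ) (x : Euc n) : 0 ≤ moll n j x := (mollBump n j).nonneg_normed x

lemma moll_continuous (j : ℕ) : Continuous (moll n j) := (mollBump n j).continuous_normed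

lemma moll_contDiff (j : ℕ) (k : ℕ∞) : ContDiff ℝ k (moll n j) := (mollBump n j).contDiff_normed

lemma moll_hasCompactSupport (j : ℕ) : HasCompactSupport (moll n j) :=
  (mollBump n j).hasCompactSupport_normed

lemma moll_sub_comm (j : ℕ) (x y : Euc n) : moll n j (x - y) = moll n j (y - x) := by
  rw [← neg_sub y x]; exact (mollBump n j).normed_neg _

lemma moll_sub_eq_zero {j : ℕ} {x y : Euc n} (h : mollRadius j ≤ dist x y) :
    moll n j (x - y) = 0 := by
  by_contra hne
  have : x - y ∈ Function.support (moll n j) := hne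
  rw [moll, (mollBump n j).support_normed_eq, mem_ball, dist_zero_right, ← dist_eq_norm] at this
  exact absurd this (not_lt.2 h)

lemma integral_moll (j : ℕ) : ∫ x, moll n j x = 1 := (mollBump n j).integral_normed

lemma moll_integrable (j : ℕ) : Integrable (moll n j) := (mollBump n j).integrable_normed

lemma integral_moll_sub_left (j : ℕ) (x : Euc n) : ∫ y, moll n j (x - y) = 1 := by
  rw [integral_sub_left_eq_self (moll n j) volume x, integral_moll]

lemma integral_moll_sub_right (j : ℕ) (y : Euc n) : ∫ x, moll n j (x - y) = 1 := by
  rw [integral_sub_right_eq_self (moll n j) y, integral_moll]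

lemma moll_le (j : ℕ) (x : Euc n) :
    moll n j x ≤ 2 ^ n / volume.real (closedBall (0 : Euc n) (mollRadius j)) := by
  have := (mollBump n j).normed_le_div_measure_closedBall_rOut volume 2
    (by simp [mollBump]; linarith) x
  simpa [moll, mollBump] using this

lemma moll_bound (n j : ℕ) : ∃ C : ℝ, 0 ≤ C ∧ ∀ x : Euc n, ‖moll n j x‖ ≤ C := by
  refine ⟨2 ^ n / volume.real (closedBall (0 : Euc n) (mollRadius j)), by positivity, fun x => ?_⟩
  rw [Real.norm_of_nonneg (moll_nonneg j x)]
  exact moll_le j x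

/-- Mollification of a function. -/
def mollify (j : ℕ) (f : Euc n → ℝ) (x : Euc n) : ℝ := ∫ y, f y * moll n j (x - y)

lemma mollify_eq_convolution (j : ℕ) (f : Euc n → ℝ) :
    mollify j f = convolution f (moll n j) (ContinuousLinearMap.mul ℝ ℝ) volume := rfl

lemma contDiff_mollify {f : Euc n → ℝ} (hf : LocallyIntegrable f) (j : ℕ) (k : ℕ∞) :
    ContDiff ℝ k (mollify j f) := by
  rw [mollify_eq_convolution]
  exact (moll_hasCompactSupport j).contDiff_convolution_right _ hf (moll_contDiff j k)

lemma fderiv_mollify {f : Euc n → ℝ} (hf : LocallyIntegrable f) (j : ℕ) (x v : Euc n) :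
    fderiv ℝ (mollify j f) x v = ∫ y, f y * fderiv ℝ (moll n j) (x - y) v := by
  rw [mollify_eq_convolution, ((moll_hasCompactSupport j).hasFDerivAt_convolution_right _ hf
    (moll_contDiff j 1) x).fderiv, convolution_precompR_apply _ hf
      ((moll_hasCompactSupport j).fderiv ℝ)
      ((moll_contDiff j 1).continuous_fderiv one_ne_zero)]
  rfl

lemma fderiv_mollify_of_contDiff {f : Euc n → ℝ} (hf : ContDiff ℝ 1 f) (hc : HasCompactSupport f)
    (j : ℕ) (x v : Euc n) :
    fderiv ℝ (mollify j f) x v = mollify j (fun y => fderiv ℝ f y v) x := by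
  have hm : LocallyIntegrable (moll n j) := (moll_integrable j).locallyIntegrable
  rw [mollify_eq_convolution, (hc.hasFDerivAt_convolution_left _ hf hm x).fderiv]
  have := convolution_precompR_apply (μ := volume) (ContinuousLinearMap.mul ℝ ℝ).flip hm (hc.fderiv ℝ)
      (hf.continuous_fderiv one_ne_zero) x v
  rw [mollify_eq_convolution]
  change (convolution (fderiv ℝ f) (moll n j)
    ((ContinuousLinearMap.mul ℝ ℝ).flip.precompR (Euc n)).flip volume x) v = _
  rw [convolution_flip, this, convolution_flip]

lemma integrable_mul_moll {f : Euc n → ℝ} (hf : Integrable f) (j : ℕ) (x : Euc n) :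
    Integrable (fun y => f y * moll n j (x - y)) := by
  obtain ⟨C, -, hC⟩ := moll_bound n j
  exact hf.mul_bdd (c := C) ((moll_continuous j).comp (continuous_const.sub continuous_id)).aestronglyMeasurable
    (ae_of_all _ fun y => hC _)

lemma integral_mollify_mul {f ζ : Euc n → ℝ} (hf : Integrable f) (hζ : Integrable ζ) (j : ℕ) :
    ∫ x, mollify j f x * ζ x = ∫ y, f y * mollify j ζ y := by
  obtain ⟨C, -, hC⟩ := moll_bound n j
  simp only [mollify, ← integral_mul_const, ← integral_const_mul]
  rw [integral_integral_swap]
  · refine integral_congr_ae (ae_of_all _ fun y => integral_congr_ae (ae_of_all _ fun x => ?_))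
    simp only [moll_sub_comm j x y]; ring
  · have h1 : Integrable (fun p : Euc n × Euc n => ζ p.1 * f p.2) (volume.prod volume) :=
      hζ.mul_prod hf
    have h2 : Continuous fun p : Euc n × Euc n => moll n j (p.1 - p.2) :=
      (moll_continuous j).comp (continuous_fst.sub continuous_snd)
    refine (h1.mul_bdd (c := C) h2.aestronglyMeasurable (ae_of_all _ fun p => hC _)).congr
      (ae_of_all _ fun p => ?_)
    simp only [Function.uncurry]; ring

/-- The vector measure `G • lam` is the distributional gradient of `f` in `Ω`. -/
def WeakGrad (Ω : Set (Euc n)) (lam : Measure (Euc n)) (f : Euc n → ℝ) (G : Euc n → Euc n) :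
    Prop :=
  ∀ φ : Euc n → ℝ, ContDiff ℝ 1 φ → HasCompactSupport φ → tsupport φ ⊆ Ω →
    ∀ v : Euc n, ∫ x, f x * fderiv ℝ φ x v = - ∫ x, φ x * ⟪v, G x⟫ ∂lam

/-- `y` is a Lebesgue point of `f` with approximate limit `c`. -/
def LebPt (f : Euc n → ℝ) (c : ℝ) (y : Euc n) : Prop :=
  Tendsto (fun r : ℝ => ⨍ z in ball y r, |f z - c|) (𝓝[>] 0) (𝓝 0)

lemma fderiv_mollify_of_weakGrad {Ω : Set (Euc n)} {lam : Measure (Euc n)} {f : Euc n → ℝ}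
    {G : Euc n → Euc n} (hf : Integrable f) (h : WeakGrad Ω lam f G) {j : ℕ} {x : Euc n}
    (hx : closedBall x (mollRadius j) ⊆ Ω) (v : Euc n) :
    fderiv ℝ (mollify j f) x v = ∫ y, moll n j (x - y) * ⟪v, G y⟫ ∂lam := by
  have hts : tsupport (fun y => moll n j (x - y)) ⊆ closedBall x (mollRadius j) := by
    refine closure_minimal (fun y hy => ?_) isClosed_closedBall
    by_contra hcon
    exact hy (moll_sub_eq_zero (by rw [dist_comm]; exact (not_le.1 hcon).le))
  have hd : ContDiff ℝ 1 (fun y => moll n j (x - y)) :=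
    (moll_contDiff j 1).comp (contDiff_const.sub contDiff_id)
  have key := h (fun y => moll n j (x - y)) hd
    (HasCompactSupport.of_support_subset_isCompact (isCompact_closedBall x (mollRadius j))
      (subset_closure.trans hts)) (hts.trans hx) v
  rw [fderiv_mollify hf.locallyIntegrable]
  have hfd : ∀ y, fderiv ℝ (fun y => moll n j (x - y)) y v = - fderiv ℝ (moll n j) (x - y) v := by
    intro y
    have h1 : HasFDerivAt (moll n j) (fderiv ℝ (moll n j) (x - y)) (x - y) :=
      ((moll_contDiff j 1).differentiable one_ne_zero _).hasFDerivAt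
    have h2 : HasFDerivAt (fun y : Euc n => x - y) (-ContinuousLinearMap.id ℝ (Euc n)) y :=
      (hasFDerivAt_id y).const_sub x
    have h3 := h1.comp y h2
    change fderiv ℝ (moll n j ∘ fun y => x - y) y v = _
    rw [h3.fderiv]; simp
  simp only [hfd, mul_neg, integral_neg, neg_inj] at key
  exact key

lemma integrable_moll_mul_norm {lam : Measure (Euc n)}
    {G : Euc n → Euc n} (hG : Integrable G lam) (j : ℕ) (x : Euc n) :
    Integrable (fun y => moll n j (x - y) * ‖G y‖) lam := by
  obtain ⟨C, -, hC⟩ := moll_bound n j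
  exact hG.norm.bdd_mul (c := C)
    ((moll_continuous j).comp (continuous_const.sub continuous_id)).aestronglyMeasurable
    (ae_of_all _ fun y => hC _)

lemma norm_fderiv_mollify_le {Ω : Set (Euc n)} {lam : Measure (Euc n)} {f : Euc n → ℝ}
    {G : Euc n → Euc n} (hf : Integrable f) (hG : Integrable G lam) (h : WeakGrad Ω lam f G)
    {j : ℕ} {x : Euc n} (hx : closedBall x (mollRadius j) ⊆ Ω) :
    ‖fderiv ℝ (mollify j f) x‖ₑ ≤ ∫⁻ y, ENNReal.ofReal (moll n j (x - y)) * ‖G y‖ₑ ∂lam := by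
  have hi := integrable_moll_mul_norm hG j x
  have h0 : ∀ y, 0 ≤ moll n j (x - y) * ‖G y‖ := fun y =>
    mul_nonneg (moll_nonneg j _) (norm_nonneg _)
  have h1 : ‖fderiv ℝ (mollify j f) x‖ ≤ ∫ y, moll n j (x - y) * ‖G y‖ ∂lam := by
    refine ContinuousLinearMap.opNorm_le_bound _ (integral_nonneg h0) fun v => ?_
    rw [fderiv_mollify_of_weakGrad hf h hx, ← integral_mul_const]
    refine norm_integral_le_of_norm_le (hi.mul_const _) (ae_of_all _ fun y => ?_)
    rw [norm_mul, Real.norm_of_nonneg (moll_nonneg j _), mul_assoc]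
    refine mul_le_mul_of_nonneg_left ?_ (moll_nonneg j _)
    rw [mul_comm]; exact norm_inner_le_norm _ _
  rw [← ofReal_norm]
  refine (ENNReal.ofReal_le_ofReal h1).trans ?_
  rw [ofReal_integral_eq_lintegral_ofReal hi (ae_of_all _ h0)]
  refine lintegral_mono fun y => ?_
  rw [ENNReal.ofReal_mul (moll_nonneg j _), ofReal_norm]

lemma lintegral_ofReal_moll (j : ℕ) (y : Euc n) :
    ∫⁻ x, ENNReal.ofReal (moll n j (x - y)) = 1 := by
  rw [← ofReal_integral_eq_lintegral_ofReal ((moll_integrable j).comp_sub_right y)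
    (ae_of_all _ fun x => moll_nonneg j _), integral_moll_sub_right, ENNReal.ofReal_one]

lemma lintegral_fderiv_mollify_le {Ω C U : Set (Euc n)} {lam : Measure (Euc n)} [SFinite lam]
    {f : Euc n → ℝ} {G : Euc n → Euc n} (hf : Integrable f) (hG : Integrable G lam)
    (h : WeakGrad Ω lam f G) {j : ℕ} (hC : MeasurableSet C) (hU : MeasurableSet U) (hUΩ : U ⊆ Ω)
    (hx : ∀ x ∈ C, closedBall x (mollRadius j) ⊆ U) :
    ∫⁻ x in C, ‖fderiv ℝ (mollify j f) x‖ₑ ≤ ∫⁻ y in U, ‖G y‖ₑ ∂lam := by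
  have hm : AEMeasurable (fun p : Euc n × Euc n =>
      ENNReal.ofReal (moll n j (p.1 - p.2)) * ‖G p.2‖ₑ) ((volume.restrict C).prod lam) := by
    have m1 : AEMeasurable (fun p : Euc n × Euc n => ENNReal.ofReal (moll n j (p.1 - p.2)))
        ((volume.restrict C).prod lam) :=
      (((moll_continuous j).comp
        (continuous_fst.sub continuous_snd)).measurable.ennreal_ofReal).aemeasurable
    have m2 : AEMeasurable (fun p : Euc n × Euc n => ‖G p.2‖ₑ) ((volume.restrict C).prod lam) :=
      hG.aestronglyMeasurable.enorm.comp_snd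
    exact m1.mul m2
  calc ∫⁻ x in C, ‖fderiv ℝ (mollify j f) x‖ₑ
      ≤ ∫⁻ x in C, (∫⁻ y, ENNReal.ofReal (moll n j (x - y)) * ‖G y‖ₑ ∂lam) :=
        setLIntegral_mono' hC fun x hxC => norm_fderiv_mollify_le hf hG h ((hx x hxC).trans hUΩ)
    _ = ∫⁻ y, (∫⁻ x in C, ENNReal.ofReal (moll n j (x - y)) * ‖G y‖ₑ) ∂lam :=
        lintegral_lintegral_swap hm
    _ ≤ ∫⁻ y, U.indicator (fun y => ‖G y‖ₑ) y ∂lam := by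
        refine lintegral_mono fun y => ?_
        have hmy : Measurable fun x : Euc n => ENNReal.ofReal (moll n j (x - y)) :=
          ((moll_continuous j).comp (continuous_id.sub continuous_const)).measurable.ennreal_ofReal
        rw [lintegral_mul_const _ hmy]
        by_cases hy : y ∈ U
        · rw [Set.indicator_of_mem hy]
          refine mul_le_of_le_one_left' ?_
          exact (setLIntegral_le_lintegral _ _).trans (lintegral_ofReal_moll j y).le
        · rw [Set.indicator_of_notMem hy]
          have : ∫⁻ x in C, ENNReal.ofReal (moll n j (x - y)) = 0 := by
            rw [setLIntegral_congr_fun hC (g := fun _ => 0)]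
            · simp
            · intro x hxC
              have : mollRadius j ≤ dist x y := by
                by_contra hlt
                exact hy (hx x hxC (by rw [mem_closedBall, dist_comm]; exact (not_le.1 hlt).le))
              simp [moll_sub_eq_zero this]
          simp [this]
    _ = ∫⁻ y in U, ‖G y‖ₑ ∂lam := lintegral_indicator hU _

lemma abs_mollify_sub_le {f : Euc n → ℝ} (hf : Integrable f) (c : ℝ) (j : ℕ) {x y : Euc n}
    (hx : x ∈ closedBall y (mollRadius j)) :
    |mollify j f x - c| ≤ 6 ^ n * ⨍ z in ball y (3 * mollRadius j), |f z - c| := by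
  have hr := mollRadius_pos j
  set r := mollRadius j with hrdef
  set V := volume.real (closedBall (0 : Euc n) r) with hV
  have hVpos : 0 < V := by
    rw [hV, measureReal_def]
    exact ENNReal.toReal_pos (measure_closedBall_pos volume 0 hr).ne' measure_closedBall_lt_top.ne
  have hV3 : volume.real (ball y (3 * r)) = 3 ^ n * V := by
    rw [hV, measureReal_def, measureReal_def, Measure.addHaar_ball_of_pos _ _ (by positivity),
      Measure.addHaar_closedBall _ _ hr.le, ENNReal.toReal_mul, ENNReal.toReal_mul,
      ENNReal.toReal_ofReal (by positivity), ENNReal.toReal_ofReal (by positivity), mul_pow]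
    simp [mul_assoc]
  have hInt : IntegrableOn (fun z => |f z - c|) (ball y (3 * r)) :=
    (hf.integrableOn.sub (integrableOn_const measure_ball_lt_top.ne)).abs
  have h1 : mollify j f x - c = ∫ z, (f z - c) * moll n j (x - z) := by
    have : (fun z => (f z - c) * moll n j (x - z)) =
        fun z => f z * moll n j (x - z) - c * moll n j (x - z) := by ext; ring
    rw [this, integral_sub (integrable_mul_moll hf j x) (((moll_integrable j).comp_sub_left x).const_mul c),
      integral_const_mul, integral_moll_sub_left, mul_one, mollify]
  rw [h1, setAverage_eq, smul_eq_mul, ← Real.norm_eq_abs]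
  calc ‖∫ z, (f z - c) * moll n j (x - z)‖
      ≤ ∫ z, (ball y (3 * r)).indicator (fun z => 2 ^ n / V * |f z - c|) z := by
        refine norm_integral_le_of_norm_le
          ((integrable_indicator_iff measurableSet_ball).2 (Integrable.const_mul hInt _)) (ae_of_all _ fun z => ?_)
        by_cases hz : z ∈ ball y (3 * r)
        · rw [Set.indicator_of_mem hz, norm_mul, Real.norm_of_nonneg (moll_nonneg j _), mul_comm,
            Real.norm_eq_abs]
          exact mul_le_mul_of_nonneg_right (moll_le j _) (abs_nonneg _)
        · rw [Set.indicator_of_notMem hz, moll_sub_eq_zero, mul_zero, norm_zero]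
          rw [mem_ball, not_lt] at hz
          rw [mem_closedBall] at hx
          have := dist_triangle z x y
          rw [dist_comm x z]; linarith
    _ = 2 ^ n / V * ∫ z in ball y (3 * r), |f z - c| := by
        rw [integral_indicator measurableSet_ball, integral_const_mul]
    _ = 6 ^ n * ((volume.real (ball y (3 * r)))⁻¹ * ∫ z in ball y (3 * r), |f z - c|) := by
        rw [hV3, show (6 : ℝ) = 2 * 3 by norm_num, mul_pow]
        field_simp

lemma LebPt.eventually_mollify {f : Euc n → ℝ} (hf : Integrable f) {c : ℝ} {y : Euc n}
    (h : LebPt f c y) {ε : ℝ} (hε : 0 < ε) :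
    ∀ᶠ j in atTop, ∀ x ∈ closedBall y (mollRadius j), |mollify j f x - c| ≤ ε := by
  have h1 : Tendsto (fun j => 3 * mollRadius j) atTop (𝓝[>] 0) := by
    refine tendsto_nhdsWithin_iff.2 ⟨by simpa using tendsto_mollRadius.const_mul 3, ?_⟩
    exact Eventually.of_forall fun j => by have := mollRadius_pos j; simp [this]
  have h2 := (h.comp h1).const_mul (6 ^ n)
  rw [mul_zero] at h2
  filter_upwards [h2.eventually (gt_mem_nhds hε)] with j hj x hx
  exact (abs_mollify_sub_le hf c j hx).trans hj.le

lemma LebPt.tendsto_mollify {f : Euc n → ℝ} (hf : Integrable f) {c : ℝ} {y : Euc n}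
    (h : LebPt f c y) : Tendsto (fun j => mollify j f y) atTop (𝓝 c) := by
  rw [Metric.tendsto_nhds]
  intro ε hε
  filter_upwards [h.eventually_mollify hf (half_pos hε)] with j hj
  have := hj y (mem_closedBall_self (mollRadius_pos j).le)
  rw [Real.dist_eq]; linarith

lemma ae_tendsto_mollify {f : Euc n → ℝ} (hf : Integrable f) :
    ∀ᵐ x, Tendsto (fun j => mollify j f x) atTop (𝓝 (f x)) := by
  have := ContDiffBump.ae_convolution_tendsto_right_of_locallyIntegrable (μ := volume)
    (φ := mollBump n) (l := atTop) (K := 2) tendsto_mollRadius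
    (Eventually.of_forall fun j => by simp only [mollBump]; linarith) hf.locallyIntegrable
  filter_upwards [this] with x hx
  refine hx.congr fun j => ?_
  rw [convolution_eq_swap, mollify]
  refine integral_congr_ae (ae_of_all _ fun y => ?_)
  simp [moll, mul_comm]

/-- Sequential weak-star compactness of `[0,1]`-valued functions, along an ultrafilter. -/
lemma exists_weak_limit {α : Type*} [MeasurableSpace α] (m : Measure α) [IsFiniteMeasure m]
    (b : ℕ → α → ℝ) (hb : ∀ j, Measurable (b j)) (h01 : ∀ j x, b j x ∈ Set.Icc (0 : ℝ) 1) :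
    ∃ (ω : Ultrafilter ℕ) (B : α → ℝ), (ω : Filter ℕ) ≤ atTop ∧ Measurable B ∧
      (∀ x, B x ∈ Set.Icc (0 : ℝ) 1) ∧
      ∀ ψ : α → ℝ, AEStronglyMeasurable ψ m → (∃ C, ∀ x, |ψ x| ≤ C) →
        Tendsto (fun j => ∫ x, b j x * ψ x ∂m) ω (𝓝 (∫ x, B x * ψ x ∂m)) := by
  have hmem : ∀ j, MemLp (b j) 2 m := fun j =>
    MemLp.of_bound (hb j).aestronglyMeasurable 1 (ae_of_all _ fun x => by
      rw [Real.norm_of_nonneg (h01 j x).1]; exact (h01 j x).2)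
  let β : ℕ → Lp ℝ 2 m := fun j => (hmem j).toLp (b j)
  obtain ⟨R, hR⟩ : ∃ R, ∀ j, ‖β j‖ ≤ R := by
    refine ⟨(m.real Set.univ) ^ (2 : ℝ≥0∞).toReal⁻¹ * 1, fun j => ?_⟩
    refine Lp.norm_le_of_ae_bound zero_le_one ?_
    filter_upwards [(hmem j).coeFn_toLp] with x hx
    rw [hx, Real.norm_of_nonneg (h01 j x).1]; exact (h01 j x).2
  let ω : Ultrafilter ℕ := Ultrafilter.of atTop
  have hω : (ω : Filter ℕ) ≤ atTop := Ultrafilter.of_le atTop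
  let D : ℕ → WeakDual ℝ (Lp ℝ 2 m) := fun j =>
    StrongDual.toWeakDual (InnerProductSpace.toDual ℝ (Lp ℝ 2 m) (β j))
  have hcpt := WeakDual.isCompact_closedBall (𝕜 := ℝ) (E := Lp ℝ 2 m) 0 R
  have hD : ∀ j, D j ∈ WeakDual.toStrongDual ⁻¹' closedBall (0 : StrongDual ℝ (Lp ℝ 2 m)) R := by
    intro j
    simp only [Set.mem_preimage, mem_closedBall, dist_zero_right]
    change ‖InnerProductSpace.toDual ℝ (Lp ℝ 2 m) (β j)‖ ≤ R
    rw [LinearIsometryEquiv.norm_map]; exact hR j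
  obtain ⟨L, -, hL⟩ := hcpt.ultrafilter_le_nhds (ω.map D)
    (by
      rw [le_principal_iff]
      exact Filter.mem_map.2 (Filter.univ_mem' hD))
  have hlim : ∀ u : Lp ℝ 2 m, Tendsto (fun j => ⟪β j, u⟫) ω (𝓝 (L u)) := by
    intro u
    have : Tendsto D ω (𝓝 L) := hL
    exact ((WeakDual.eval_continuous u).tendsto L).comp this
  let B₀ : Lp ℝ 2 m := (InnerProductSpace.toDual ℝ (Lp ℝ 2 m)).symm (WeakDual.toStrongDual L)
  have hB₀ : ∀ u, L u = ⟪B₀, u⟫ := by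
    intro u
    have := InnerProductSpace.toDual_symm_apply (𝕜 := ℝ) (x := u) (y := WeakDual.toStrongDual L)
    rw [this]; rfl
  have hmain : ∀ ψ : α → ℝ, AEStronglyMeasurable ψ m → (∃ C, ∀ x, |ψ x| ≤ C) →
      Tendsto (fun j => ∫ x, b j x * ψ x ∂m) ω (𝓝 (∫ x, B₀ x * ψ x ∂m)) := by
    rintro ψ hψ ⟨C, hC⟩
    have hψm : MemLp ψ 2 m := MemLp.of_bound hψ C (ae_of_all _ hC)
    have := hlim (hψm.toLp ψ)
    rw [hB₀, L2.inner_def] at this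
    have e1 : ∫ a, ⟪B₀ a, (hψm.toLp ψ : Lp ℝ 2 m) a⟫ ∂m = ∫ x, B₀ x * ψ x ∂m := by
      refine integral_congr_ae ?_
      filter_upwards [hψm.coeFn_toLp] with x hx
      rw [hx]; simp [mul_comm]
    rw [e1] at this
    refine this.congr fun j => ?_
    rw [L2.inner_def]
    refine integral_congr_ae ?_
    filter_upwards [hψm.coeFn_toLp, (hmem j).coeFn_toLp] with x hx hx'
    rw [hx, hx']; simp [mul_comm]
  have hB₀i : Integrable B₀ m := (Lp.memLp B₀).integrable (by norm_num)
  have hset : ∀ s, MeasurableSet s → Tendsto (fun j => ∫ x in s, b j x ∂m) ω (𝓝 (∫ x in s, B₀ x ∂m)) := by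
    intro s hs
    have := hmain (s.indicator 1) ((measurable_one.indicator hs).aestronglyMeasurable)
      ⟨1, fun x => by by_cases hx : x ∈ s <;> simp [hx]⟩
    have e : ∀ g : α → ℝ, ∫ x, g x * s.indicator 1 x ∂m = ∫ x in s, g x ∂m := by
      intro g
      rw [← integral_indicator hs]
      refine integral_congr_ae (ae_of_all _ fun x => ?_)
      by_cases hx : x ∈ s <;> simp [hx]
    simpa only [e] using this
  have hbi : ∀ j, Integrable (b j) m := fun j => (hmem j).integrable (by norm_num)
  have h0 : 0 ≤ᵐ[m] B₀ := by
    refine ae_nonneg_of_forall_setIntegral_nonneg hB₀i fun s hs _ => ?_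
    exact ge_of_tendsto' (hset s hs) fun j => integral_nonneg fun x => (h01 j x).1
  have h1 : B₀ ≤ᵐ[m] fun _ => (1 : ℝ) := by
    refine ae_le_of_forall_setIntegral_le hB₀i (integrable_const 1) fun s hs _ => ?_
    exact le_of_tendsto' (hset s hs) fun j => integral_mono (hbi j).integrableOn
      (integrable_const 1) fun x => (h01 j x).2
  have hBm : AEMeasurable B₀ m := (Lp.aestronglyMeasurable B₀).aemeasurable
  refine ⟨ω, fun x => max 0 (min 1 (hBm.mk B₀ x)), hω, ?_, ?_, ?_⟩
  · exact measurable_const.max (measurable_const.min hBm.measurable_mk)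
  · intro x
    exact ⟨le_max_left _ _, max_le zero_le_one (min_le_left _ _)⟩
  · intro ψ hψ hC
    convert hmain ψ hψ hC using 2
    refine integral_congr_ae ?_
    filter_upwards [h0, h1, hBm.ae_eq_mk] with x hx0 hx1 hx
    rw [← hx, min_eq_right hx1, max_eq_right (show (0 : ℝ) ≤ B₀ x from hx0)]

/-- A weak limit agrees with a pointwise limit wherever the latter exists. -/
lemma weak_limit_eq_of_tendsto {α : Type*} [MeasurableSpace α] {m : Measure α} [IsFiniteMeasure m]
    {b : ℕ → α → ℝ} (hb : ∀ j, Measurable (b j)) (h01 : ∀ j x, b j x ∈ Set.Icc (0 : ℝ) 1)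
    {ω : Ultrafilter ℕ} {B : α → ℝ} (hω : (ω : Filter ℕ) ≤ atTop) (hB : Measurable B)
    (hB01 : ∀ x, B x ∈ Set.Icc (0 : ℝ) 1)
    (hlim : ∀ ψ : α → ℝ, AEStronglyMeasurable ψ m → (∃ C, ∀ x, |ψ x| ≤ C) →
        Tendsto (fun j => ∫ x, b j x * ψ x ∂m) ω (𝓝 (∫ x, B x * ψ x ∂m)))
    {A : Set α} (hA : MeasurableSet A) {β : α → ℝ}
    (hβ : ∀ x ∈ A, Tendsto (fun j => b j x) atTop (𝓝 (β x))) :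
    ∀ᵐ x ∂(m.restrict A), B x = β x := by
  have hae : ∀ᵐ x ∂(m.restrict A), Tendsto (fun j => b j x) atTop (𝓝 (β x)) :=
    (ae_restrict_mem hA).mono hβ
  have hβm : AEStronglyMeasurable β (m.restrict A) :=
    aestronglyMeasurable_of_tendsto_ae atTop (fun j => (hb j).aestronglyMeasurable) hae
  have hβi : Integrable β (m.restrict A) := by
    refine Integrable.of_bound hβm 1 (hae.mono fun x hx => ?_)
    refine le_of_tendsto' hx.norm fun j => ?_
    rw [Real.norm_of_nonneg (h01 j x).1]; exact (h01 j x).2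
  have hBi : Integrable B (m.restrict A) :=
    Integrable.of_bound hB.aestronglyMeasurable 1 (ae_of_all _ fun x => by
      rw [Real.norm_of_nonneg (hB01 x).1]; exact (hB01 x).2)
  refine hBi.ae_eq_of_forall_setIntegral_eq _ _ hβi fun s hs _ => ?_
  have key := hlim ((s ∩ A).indicator 1)
    ((measurable_one.indicator (hs.inter hA)).aestronglyMeasurable)
    ⟨1, fun x => by by_cases hx : x ∈ s ∩ A <;> simp [hx]⟩
  have e : ∀ g : α → ℝ, ∫ x, g x * (s ∩ A).indicator 1 x ∂m = ∫ x in s, g x ∂(m.restrict A) := by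
    intro g
    rw [Measure.restrict_restrict hs, ← integral_indicator (hs.inter hA)]
    refine integral_congr_ae (ae_of_all _ fun x => ?_)
    by_cases hx : x ∈ s ∩ A <;> simp [hx]
  simp only [e] at key
  refine tendsto_nhds_unique key (Tendsto.mono_left ?_ hω)
  refine tendsto_integral_of_dominated_convergence (fun _ => 1)
    (fun j => (hb j).aestronglyMeasurable) (integrable_const 1) (fun j => ae_of_all _ fun x => ?_)
    (ae_restrict_of_ae hae)
  rw [Real.norm_of_nonneg (h01 j x).1]; exact (h01 j x).2

lemma integral_mul_integral_moll {lam : Measure (Euc n)} [SFinite lam] {ζ k : Euc n → ℝ}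
    (hζ : Integrable ζ) (hk : Integrable k lam) (j : ℕ) :
    ∫ x, ζ x * (∫ y, moll n j (x - y) * k y ∂lam) = ∫ y, k y * mollify j ζ y ∂lam := by
  obtain ⟨C, -, hC⟩ := moll_bound n j
  simp only [mollify, ← integral_const_mul]
  rw [integral_integral_swap]
  · refine integral_congr_ae (ae_of_all _ fun y => integral_congr_ae (ae_of_all _ fun x => ?_))
    simp only [moll_sub_comm j x y]; ring
  · have h1 : Integrable (fun p : Euc n × Euc n => ζ p.1 * k p.2) (volume.prod lam) :=
      hζ.mul_prod hk
    have h2 : Continuous fun p : Euc n × Euc n => moll n j (p.1 - p.2) :=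
      (moll_continuous j).comp (continuous_fst.sub continuous_snd)
    refine (h1.mul_bdd (c := C) h2.aestronglyMeasurable (ae_of_all _ fun p => hC _)).congr
      (ae_of_all _ fun p => ?_)
    simp only [Function.uncurry]; ring

lemma integrable_continuous_mul_moll {w : Euc n → ℝ} (hw : Continuous w) (j : ℕ) (y : Euc n) :
    Integrable fun x => w x * moll n j (y - x) := by
  have hc : Continuous fun x => w x * moll n j (y - x) :=
    hw.mul ((moll_continuous j).comp (continuous_const.sub continuous_id))
  refine hc.integrable_of_hasCompactSupport ?_
  refine HasCompactSupport.of_support_subset_isCompact (isCompact_closedBall y (mollRadius j))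
    fun x hx => ?_
  by_contra hcon
  refine hx ?_
  simp only
  rw [moll_sub_eq_zero, mul_zero]
  rw [dist_comm]; exact (not_le.1 hcon).le

lemma mollify_mem_Icc {w : Euc n → ℝ} (hw : Continuous w) {a b : ℝ}
    (h : ∀ x, w x ∈ Set.Icc a b) (j : ℕ) (y : Euc n) : mollify j w y ∈ Set.Icc a b := by
  have hi := (moll_integrable (n := n) j).comp_sub_left y
  have e : ∀ c : ℝ, ∫ x, c * moll n j (y - x) = c := fun c => by
    rw [integral_const_mul, integral_moll_sub_left, mul_one]
  constructor
  · rw [← e a]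
    exact integral_mono (hi.const_mul a) (integrable_continuous_mul_moll hw j y) fun x =>
      mul_le_mul_of_nonneg_right (h x).1 (moll_nonneg j _)
  · rw [← e b]
    exact integral_mono (integrable_continuous_mul_moll hw j y) (hi.const_mul b) fun x =>
      mul_le_mul_of_nonneg_right (h x).2 (moll_nonneg j _)

lemma abs_mollify_le_of_closedBall {w : Euc n → ℝ} {j : ℕ} {y : Euc n} {ε : ℝ}
    (h : ∀ x ∈ closedBall y (mollRadius j), |w x| ≤ ε) : |mollify j w y| ≤ ε := by
  have hi := (moll_integrable (n := n) j).comp_sub_left y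
  rw [← Real.norm_eq_abs, mollify]
  calc ‖∫ x, w x * moll n j (y - x)‖ ≤ ∫ x, ε * moll n j (y - x) := by
        refine norm_integral_le_of_norm_le (hi.const_mul ε) (ae_of_all _ fun x => ?_)
        by_cases hx : x ∈ closedBall y (mollRadius j)
        · rw [norm_mul, Real.norm_of_nonneg (moll_nonneg j _)]
          exact mul_le_mul_of_nonneg_right (h x hx) (moll_nonneg j _)
        · rw [moll_sub_eq_zero]
          · simp
          · rw [dist_comm]; exact (not_le.1 hx).le
    _ = ε := by rw [integral_const_mul, integral_moll_sub_left, mul_one]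

lemma mollify_sub_const {w : Euc n → ℝ} (hw : Continuous w) (j : ℕ) (c : ℝ) (y : Euc n) :
    mollify j (fun x => w x - c) y = mollify j w y - c := by
  have hi := (moll_integrable (n := n) j).comp_sub_left y
  simp only [mollify, sub_mul]
  rw [integral_sub (integrable_continuous_mul_moll hw j y) (hi.const_mul c), integral_const_mul,
    integral_moll_sub_left, mul_one]

lemma abs_mollify_mul_sub_le {φ w : Euc n → ℝ} (hφ : Continuous φ) (hw : Continuous w)
    (hw01 : ∀ x, w x ∈ Set.Icc (0 : ℝ) 1) {ε : ℝ} {j : ℕ}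
    (h : ∀ x y, dist x y ≤ mollRadius j → |φ x - φ y| ≤ ε) (y : Euc n) :
    |mollify j (fun x => φ x * w x) y - φ y * mollify j w y| ≤ ε := by
  have e : mollify j (fun x => φ x * w x) y - φ y * mollify j w y =
      mollify j (fun x => (φ x - φ y) * w x) y := by
    simp only [mollify]
    have hi : Integrable fun x => φ x * w x * moll n j (y - x) :=
      integrable_continuous_mul_moll (hφ.mul hw) j y
    rw [← integral_const_mul, ← integral_sub hi
      ((integrable_continuous_mul_moll hw j y).const_mul _)]
    exact integral_congr_ae (ae_of_all _ fun x => by simp only; ring)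
  rw [e]
  refine abs_mollify_le_of_closedBall fun x hx => ?_
  rw [abs_mul, abs_of_nonneg (hw01 x).1]
  have h1 := h x y hx
  exact (mul_le_of_le_one_right (abs_nonneg _) (hw01 x).2).trans h1

lemma eventually_closedBall_mollRadius_subset {K U : Set (Euc n)} (hK : IsCompact K) (hU : IsOpen U)
    (h : K ⊆ U) : ∀ᶠ j in atTop, ∀ x ∈ K, closedBall x (mollRadius j) ⊆ U := by
  obtain ⟨d, hd, hdU⟩ := hK.exists_cthickening_subset_open hU h
  filter_upwards [tendsto_mollRadius.eventually (gt_mem_nhds hd)] with j hj x hx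
  refine Set.Subset.trans ?_ hdU
  exact (closedBall_subset_closedBall hj.le).trans (closedBall_subset_cthickening hx d)

/-- Integration by parts for the composition of a `C¹` function with the difference of a `C¹`
function and a mollified function. -/
lemma integral_comp_mollify_fderiv {Ω : Set (Euc n)} {lam : Measure (Euc n)} [SFinite lam]
    {f : Euc n → ℝ} {G : Euc n → Euc n} (hf : Integrable f) (hG : Integrable G lam)
    (h : WeakGrad Ω lam f G) {g : Euc n → ℝ} (hg : ContDiff ℝ 1 g) {T : ℝ → ℝ}
    (hT : ContDiff ℝ 1 T) {φ : Euc n → ℝ} (hφ : ContDiff ℝ 1 φ) (hφc : HasCompactSupport φ)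
    {j : ℕ} (hj : ∀ x ∈ tsupport φ, closedBall x (mollRadius j) ⊆ Ω) (v : Euc n) :
    ∫ x, T (g x - mollify j f x) * fderiv ℝ φ x v =
      - ((∫ x, φ x * (deriv T (g x - mollify j f x) * fderiv ℝ g x v)) -
        ∫ y, ⟪v, G y⟫ * mollify j (fun x => φ x * deriv T (g x - mollify j f x)) y ∂lam) := by
  have hm : ContDiff ℝ 1 (mollify j f) := contDiff_mollify hf.locallyIntegrable j 1
  have hgm : ContDiff ℝ 1 (fun x => g x - mollify j f x) := hg.sub hm
  have hu : ContDiff ℝ 1 (fun x => T (g x - mollify j f x)) := hT.comp hgm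
  have hT' : Continuous (deriv T) := hT.continuous_deriv le_rfl
  have hw : Continuous fun x => deriv T (g x - mollify j f x) := hT'.comp hgm.continuous
  have hφ' : Continuous fun x => fderiv ℝ φ x v :=
    (hφ.continuous_fderiv one_ne_zero).clm_apply continuous_const
  have hg' : Continuous fun x => fderiv ℝ g x v :=
    (hg.continuous_fderiv one_ne_zero).clm_apply continuous_const
  have hm' : Continuous fun x => fderiv ℝ (mollify j f) x v :=
    (hm.continuous_fderiv one_ne_zero).clm_apply continuous_const
  have hu' : Continuous fun x => fderiv ℝ (fun x => T (g x - mollify j f x)) x v :=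
    (hu.continuous_fderiv one_ne_zero).clm_apply continuous_const
  have hφsupp : HasCompactSupport fun x => fderiv ℝ φ x v :=
    hφc.fderiv_apply (𝕜 := ℝ) v
  have hfd : ∀ x, fderiv ℝ (fun x => T (g x - mollify j f x)) x v =
      deriv T (g x - mollify j f x) * fderiv ℝ g x v -
        deriv T (g x - mollify j f x) * fderiv ℝ (mollify j f) x v := by
    intro x
    have h1 : HasFDerivAt (fun x => g x - mollify j f x)
        (fderiv ℝ g x - fderiv ℝ (mollify j f) x) x :=
      ((hg.differentiable one_ne_zero x).hasFDerivAt).sub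
        ((hm.differentiable one_ne_zero x).hasFDerivAt)
    have h2 : HasDerivAt T (deriv T (g x - mollify j f x)) (g x - mollify j f x) :=
      (hT.differentiable one_ne_zero _).hasDerivAt
    have h3 := h2.comp_hasFDerivAt x h1
    change fderiv ℝ (T ∘ fun x => g x - mollify j f x) x v = _
    rw [h3.fderiv]; simp [mul_sub]
  rw [integral_mul_fderiv_eq_neg_fderiv_mul_of_integrable
    ((hu'.mul hφ.continuous).integrable_of_hasCompactSupport hφc.mul_left)
    ((hu.continuous.mul hφ').integrable_of_hasCompactSupport hφsupp.mul_left)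
    ((hu.continuous.mul hφ.continuous).integrable_of_hasCompactSupport hφc.mul_left)
    (fun x _ => hu.differentiable one_ne_zero x) (fun x _ => hφ.differentiable one_ne_zero x)]
  have hk : Integrable (fun y => ⟪v, G y⟫) lam := hG.const_inner v
  have hφw : Integrable fun x => φ x * deriv T (g x - mollify j f x) :=
    (hφ.continuous.mul hw).integrable_of_hasCompactSupport hφc.mul_right
  rw [← integral_mul_integral_moll hφw hk j]
  have hi₁ : Integrable fun x => φ x * (deriv T (g x - mollify j f x) * fderiv ℝ g x v) :=
    (hφ.continuous.mul (hw.mul hg')).integrable_of_hasCompactSupport hφc.mul_right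
  rw [← integral_sub hi₁]
  · congr 1
    refine integral_congr_ae (ae_of_all _ fun x => ?_)
    simp only
    rw [hfd]
    by_cases hx : x ∈ tsupport φ
    · rw [← fderiv_mollify_of_weakGrad hf h (hj x hx) v]; ring
    · rw [image_eq_zero_of_notMem_tsupport hx]; ring
  · refine (((hφ.continuous.mul hw).mul hm').integrable_of_hasCompactSupport
      (hφc.mul_right.mul_right)).congr (ae_of_all _ fun x => ?_)
    simp only
    by_cases hx : x ∈ tsupport φ
    · rw [← fderiv_mollify_of_weakGrad hf h (hj x hx) v]; rfl
    · simp [image_eq_zero_of_notMem_tsupport hx]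

lemma LebPt.tendsto_mollify_comp {f g : Euc n → ℝ} (hf : Integrable f) (hg : Continuous g)
    {T' : ℝ → ℝ} (hT' : Continuous T') {c : ℝ} {y : Euc n} (h : LebPt f c y) :
    Tendsto (fun j => mollify j (fun x => T' (g x - mollify j f x)) y) atTop
      (𝓝 (T' (g y - c))) := by
  rw [Metric.tendsto_nhds]
  intro ε hε
  obtain ⟨d, hd, hdT⟩ := Metric.continuousAt_iff.1 (hT'.continuousAt (x := g y - c)) (ε / 2)
    (half_pos hε)
  obtain ⟨ρ, hρ, hρg⟩ := Metric.continuousAt_iff.1 (hg.continuousAt (x := y)) (d / 2) (half_pos hd)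
  filter_upwards [h.eventually_mollify hf (show 0 < d / 3 by positivity),
    tendsto_mollRadius.eventually (gt_mem_nhds hρ)] with j hj hjρ
  have hw : Continuous fun x => T' (g x - mollify j f x) :=
    hT'.comp (hg.sub (contDiff_mollify hf.locallyIntegrable j 0).continuous)
  rw [Real.dist_eq, ← mollify_sub_const hw]
  refine lt_of_le_of_lt (abs_mollify_le_of_closedBall fun x hx => ?_) (half_lt_self hε)
  rw [← Real.dist_eq]
  refine (hdT ?_).le
  have h1 := hj x hx
  have h2 := hρg ((mem_closedBall.1 hx).trans_lt hjρ)
  rw [Real.dist_eq] at h2 ⊢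
  rw [show g x - mollify j f x - (g y - c) = (g x - g y) - (mollify j f x - c) by ring]
  exact (abs_sub _ _).trans_lt (by linarith)

lemma isFiniteMeasure_withDensity_enorm {lam : Measure (Euc n)} {G : Euc n → Euc n}
    (hG : Integrable G lam) : IsFiniteMeasure (lam.withDensity fun x => ‖G x‖ₑ) :=
  isFiniteMeasure_withDensity hG.2.ne

lemma integral_withDensity_enorm {lam : Measure (Euc n)} {G : Euc n → Euc n} (hG : Measurable G)
    (k : Euc n → ℝ) : ∫ x, k x ∂(lam.withDensity fun x => ‖G x‖ₑ) = ∫ x, ‖G x‖ * k x ∂lam := by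
  rw [integral_withDensity_eq_integral_toReal_smul hG.enorm (ae_of_all _ fun x => enorm_lt_top)]
  simp

/-- A chain rule for `T (g - f)` with `g` of class `C¹` and `f` a function whose distributional
gradient is the measure `G • lam`. -/
lemma exists_chain {Ω : Set (Euc n)} (hΩ : IsOpen Ω) {lam : Measure (Euc n)} [SFinite lam]
    {f : Euc n → ℝ} {G : Euc n → Euc n} (hf : Integrable f) (hG : Integrable G lam)
    (hGm : Measurable G) (h : WeakGrad Ω lam f G) {g : Euc n → ℝ} (hg : ContDiff ℝ 1 g)
    {T : ℝ → ℝ} (hT : ContDiff ℝ 1 T) (hT' : ∀ t, deriv T t ∈ Set.Icc (0 : ℝ) 1) {M : ℝ}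
    (hM : ∀ t, |T t| ≤ M) :
    ∃ b : Euc n → ℝ, Measurable b ∧ (∀ x, b x ∈ Set.Icc (0 : ℝ) 1) ∧
      (∀ φ : Euc n → ℝ, ContDiff ℝ 1 φ → HasCompactSupport φ → tsupport φ ⊆ Ω → ∀ v : Euc n,
        ∫ x, T (g x - f x) * fderiv ℝ φ x v =
          - ((∫ x, φ x * (deriv T (g x - f x) * fderiv ℝ g x v)) -
            ∫ y, φ y * (b y * ⟪v, G y⟫) ∂lam)) ∧
      ∀ (A : Set (Euc n)) (c : Euc n → ℝ), MeasurableSet A → (∀ y ∈ A, LebPt f (c y) y) →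
        ∀ᵐ y ∂((lam.withDensity fun x => ‖G x‖ₑ).restrict A), b y = deriv T (g y - c y) := by
  have := isFiniteMeasure_withDensity_enorm hG
  have hTc : Continuous (deriv T) := hT.continuous_deriv le_rfl
  let w : ℕ → Euc n → ℝ := fun j x => deriv T (g x - mollify j f x)
  have hw : ∀ j, Continuous (w j) := fun j =>
    hTc.comp (hg.continuous.sub (contDiff_mollify hf.locallyIntegrable j 0).continuous)
  have hw01 : ∀ j x, w j x ∈ Set.Icc (0 : ℝ) 1 := fun j x => hT' _
  have hbm : ∀ j, Measurable (mollify j (w j)) := fun j =>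
    (contDiff_mollify (hw j).locallyIntegrable j 0).continuous.measurable
  have hb01 : ∀ j y, mollify j (w j) y ∈ Set.Icc (0 : ℝ) 1 := fun j y =>
    mollify_mem_Icc (hw j) (hw01 j) j y
  obtain ⟨ω, b, hω, hbmeas, hb, hlim⟩ := exists_weak_limit
    (lam.withDensity fun x => ‖G x‖ₑ) (fun j => mollify j (w j)) hbm hb01
  refine ⟨b, hbmeas, hb, ?_, ?_⟩
  · intro φ hφ hφc hφΩ v
    have hae := ae_tendsto_mollify hf
    have hφ' : Continuous fun x => fderiv ℝ φ x v :=
      (hφ.continuous_fderiv one_ne_zero).clm_apply continuous_const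
    have hg' : Continuous fun x => fderiv ℝ g x v :=
      (hg.continuous_fderiv one_ne_zero).clm_apply continuous_const
    have hφsupp : HasCompactSupport fun x => fderiv ℝ φ x v := hφc.fderiv_apply (𝕜 := ℝ) v
    have hmc : ∀ j, Continuous (mollify j f) := fun j =>
      (contDiff_mollify hf.locallyIntegrable j 0).continuous
    have L1 : Tendsto (fun j => ∫ x, T (g x - mollify j f x) * fderiv ℝ φ x v) ω
        (𝓝 (∫ x, T (g x - f x) * fderiv ℝ φ x v)) := by
      refine Tendsto.mono_left ?_ hω
      refine tendsto_integral_of_dominated_convergence (fun x => M * |fderiv ℝ φ x v|)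
        (fun j => ((hT.continuous.comp (hg.continuous.sub (hmc j))).mul
          hφ').aestronglyMeasurable)
        (((hφ'.integrable_of_hasCompactSupport hφsupp).abs).const_mul M)
        (fun j => ae_of_all _ fun x => ?_) ?_
      · rw [norm_mul, Real.norm_eq_abs, Real.norm_eq_abs]
        exact mul_le_mul_of_nonneg_right (hM _) (abs_nonneg _)
      · filter_upwards [hae] with x hx
        exact ((hT.continuous.tendsto _).comp (hx.const_sub (g x))).mul_const _
    have L2 : Tendsto (fun j => ∫ x, φ x * (deriv T (g x - mollify j f x) * fderiv ℝ g x v)) ω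
        (𝓝 (∫ x, φ x * (deriv T (g x - f x) * fderiv ℝ g x v))) := by
      refine Tendsto.mono_left ?_ hω
      refine tendsto_integral_of_dominated_convergence (fun x => |φ x * fderiv ℝ g x v|)
        (fun j => (hφ.continuous.mul ((hw j).mul hg')).aestronglyMeasurable)
        (((hφ.continuous.mul hg').integrable_of_hasCompactSupport hφc.mul_right).abs)
        (fun j => ae_of_all _ fun x => ?_) ?_
      · rw [norm_mul, norm_mul, Real.norm_of_nonneg (hT' _).1, abs_mul, Real.norm_eq_abs,
          Real.norm_eq_abs]
        exact mul_le_mul_of_nonneg_left (mul_le_of_le_one_left (abs_nonneg _) (hT' _).2)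
          (abs_nonneg _)
      · filter_upwards [hae] with x hx
        exact (((hTc.tendsto _).comp (hx.const_sub (g x))).mul_const _).const_mul _
    have hk : Integrable (fun y => ⟪v, G y⟫) lam := hG.const_inner v
    obtain ⟨Cφ, hCφ⟩ := hφ.continuous.bounded_above_of_compact_support hφc
    have L3 : Tendsto (fun j => ∫ y, φ y * (mollify j (w j) y * ⟪v, G y⟫) ∂lam) ω
        (𝓝 (∫ y, φ y * (b y * ⟪v, G y⟫) ∂lam)) := by
      have key := hlim (fun y => φ y * ⟪v, ‖G y‖⁻¹ • G y⟫) ?_ ?_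
      · have e : ∀ k : Euc n → ℝ, ∫ y, k y * (φ y * ⟪v, ‖G y‖⁻¹ • G y⟫)
            ∂(lam.withDensity fun x => ‖G x‖ₑ) = ∫ y, φ y * (k y * ⟪v, G y⟫) ∂lam := by
          intro k
          rw [integral_withDensity_enorm hGm]
          refine integral_congr_ae (ae_of_all _ fun y => ?_)
          simp only [inner_smul_right]
          by_cases hy : G y = 0
          · simp [hy]
          · have := norm_ne_zero_iff.2 hy
            field_simp
        simpa only [e] using key
      · exact (hφ.continuous.measurable.mul
          (measurable_const.inner (hGm.norm.inv.smul hGm))).aestronglyMeasurable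
      · refine ⟨Cφ * ‖v‖, fun y => ?_⟩
        have h1 : ‖‖G y‖⁻¹ • G y‖ ≤ 1 := by
          rw [norm_smul, norm_inv, norm_norm]; exact inv_mul_le_one
        rw [abs_mul]
        refine mul_le_mul (hCφ y) ?_ (abs_nonneg _) ((norm_nonneg _).trans (hCφ y))
        exact (abs_real_inner_le_norm _ _).trans (mul_le_of_le_one_right (norm_nonneg _) h1)
    have L4 : Tendsto (fun j => (∫ y, ⟪v, G y⟫ * mollify j (fun x => φ x * w j x) y ∂lam) -
        ∫ y, φ y * (mollify j (w j) y * ⟪v, G y⟫) ∂lam) atTop (𝓝 0) := by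
      rw [Metric.tendsto_nhds]
      intro ε hε
      set I := ∫ y, |⟪v, G y⟫| ∂lam with hI
      have hI0 : 0 ≤ I := integral_nonneg fun y => abs_nonneg _
      obtain ⟨d, hd, hdφ⟩ := Metric.uniformContinuous_iff.1
        (hφc.uniformContinuous_of_continuous hφ.continuous) (ε / (I + 1)) (by positivity)
      filter_upwards [tendsto_mollRadius.eventually (gt_mem_nhds hd)] with j hj
      have hqm : Continuous (mollify j fun x => φ x * w j x) :=
        (contDiff_mollify (hφ.continuous.mul (hw j)).locallyIntegrable j 0).continuous
      have hdiff := abs_mollify_mul_sub_le hφ.continuous (hw j) (hw01 j) (ε := ε / (I + 1)) (j := j)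
        fun x y hxy => by
          rw [← Real.dist_eq]; exact (hdφ (hxy.trans_lt hj)).le
      have i2 : Integrable (fun y => φ y * (mollify j (w j) y * ⟪v, G y⟫)) lam := by
        refine Integrable.bdd_mul (c := Cφ) ?_ hφ.continuous.aestronglyMeasurable (ae_of_all _ hCφ)
        refine Integrable.bdd_mul (c := 1) hk (hbm j).aestronglyMeasurable (ae_of_all _ fun y => ?_)
        rw [Real.norm_of_nonneg (hb01 j y).1]; exact (hb01 j y).2
      have i3 : Integrable (fun y => ⟪v, G y⟫ * (mollify j (fun x => φ x * w j x) y -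
          φ y * mollify j (w j) y)) lam := by
        refine hk.mul_bdd (c := ε / (I + 1))
          (hqm.sub (hφ.continuous.mul
            (contDiff_mollify (hw j).locallyIntegrable j 0).continuous)).aestronglyMeasurable
          (ae_of_all _ hdiff)
      have i1 : Integrable (fun y => ⟪v, G y⟫ * mollify j (fun x => φ x * w j x) y) lam := by
        refine (i3.add i2).congr (ae_of_all _ fun y => ?_)
        simp only [Pi.add_apply]; ring
      rw [← integral_sub i1 i2, dist_zero_right]
      refine lt_of_le_of_lt (norm_integral_le_of_norm_le
        (g := fun y => |⟪v, G y⟫| * (ε / (I + 1))) (hk.abs.mul_const _)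
        (ae_of_all _ fun y => ?_)) ?_
      · rw [show ⟪v, G y⟫ * mollify j (fun x => φ x * w j x) y -
          φ y * (mollify j (w j) y * ⟪v, G y⟫) = ⟪v, G y⟫ * (mollify j (fun x => φ x * w j x) y -
          φ y * mollify j (w j) y) by ring, norm_mul]
        exact mul_le_mul_of_nonneg_left (hdiff y) (abs_nonneg _)
      · rw [integral_mul_const, ← hI, mul_div_assoc', div_lt_iff₀ (by positivity)]
        nlinarith
    have L5 : Tendsto (fun j => ∫ y, ⟪v, G y⟫ * mollify j (fun x => φ x * w j x) y ∂lam) ω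
        (𝓝 (∫ y, φ y * (b y * ⟪v, G y⟫) ∂lam)) := by
      have := (L4.mono_left hω).add L3
      simpa using this
    refine tendsto_nhds_unique L1 ((L2.sub L5).neg.congr' ?_)
    filter_upwards [hω (eventually_closedBall_mollRadius_subset hφc hΩ hφΩ)] with j hj
    exact (integral_comp_mollify_fderiv hf hG h hg hT hφ hφc hj v).symm
  · intro A c hA hAc
    exact weak_limit_eq_of_tendsto hbm hb01 hω hbmeas hb hlim hA fun y hy =>
      (hAc y hy).tendsto_mollify_comp hf hg.continuous hTc

lemma exists_nnreal_density {α : Type*} [MeasurableSpace α] {μ κ : Measure α} [IsFiniteMeasure μ]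
    [IsFiniteMeasure κ] (h : μ ≤ κ) :
    ∃ p : α → NNReal, Measurable p ∧ μ = κ.withDensity fun x => (p x : ℝ≥0∞) := by
  refine ⟨fun x => (μ.rnDeriv κ x).toNNReal, (Measure.measurable_rnDeriv μ κ).ennreal_toNNReal, ?_⟩
  rw [← Measure.withDensity_rnDeriv_eq μ κ (Measure.absolutelyContinuous_of_le h)]
  refine withDensity_congr_ae ?_
  rw [Measure.withDensity_rnDeriv_eq μ κ (Measure.absolutelyContinuous_of_le h)]
  filter_upwards [Measure.rnDeriv_lt_top μ κ] with x hx
  rw [ENNReal.coe_toNNReal hx.ne]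

lemma IsVariationPair.unique {Ω : Set (Euc n)} (hΩ : IsOpen Ω) {f : Euc n → ℝ}
    {μ ν : Measure (Euc n)} {σ τ : Euc n → Euc n} (h : IsVariationPair n f Ω μ σ)
    (h' : IsVariationPair n f Ω ν τ) : μ = ν := by
  obtain ⟨hμ, hμΩ, hσ, hσ1, hμφ⟩ := h
  obtain ⟨hν, hνΩ, hτ, hτ1, hνφ⟩ := h'
  have hκΩ : (μ + ν) Ωᶜ = 0 := by simp [hμΩ, hνΩ]
  obtain ⟨p, hp, hpμ⟩ := exists_nnreal_density (μ := μ) (κ := μ + ν) (Measure.le_add_right le_rfl)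
  obtain ⟨q, hq, hqν⟩ := exists_nnreal_density (μ := ν) (κ := μ + ν) (Measure.le_add_left le_rfl)
  set κ := μ + ν with hκ
  have hσi : Integrable σ μ := Integrable.of_bound hσ 1 (hσ1.mono fun x hx => hx.le)
  have hτi : Integrable τ ν := Integrable.of_bound hτ 1 (hτ1.mono fun x hx => hx.le)
  have hpσ : Integrable (fun x => p x • σ x) κ := by
    rw [hpμ] at hσi; exact (integrable_withDensity_iff_integrable_smul hp).1 hσi
  have hqτ : Integrable (fun x => q x • τ x) κ := by
    rw [hqν] at hτi; exact (integrable_withDensity_iff_integrable_smul hq).1 hτi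
  have hzero := IsOpen.ae_eq_zero_of_integral_contDiff_smul_eq_zero hΩ
    (f := fun x => p x • σ x - q x • τ x) (μ := κ)
    ((hpσ.sub hqτ).locallyIntegrable.locallyIntegrableOn _) ?_
  · have heq : ∀ᵐ x ∂κ, p x = q x := by
      rw [hpμ, ae_withDensity_iff hp.coe_nnreal_ennreal] at hσ1
      rw [hqν, ae_withDensity_iff hq.coe_nnreal_ennreal] at hτ1
      have hΩae : ∀ᵐ x ∂κ, x ∈ Ω := by
        rw [ae_iff]; exact hκΩ
      filter_upwards [hσ1, hτ1, hzero, hΩae] with x h1 h2 h3 h4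
      have h5 : p x • σ x = q x • τ x := sub_eq_zero.1 (h3 h4)
      have e1 : ‖p x • σ x‖ = p x := by
        by_cases h0 : p x = 0
        · simp [h0]
        · rw [NNReal.smul_def, norm_smul, h1 (by simpa using h0)]; simp
      have e2 : ‖q x • τ x‖ = q x := by
        by_cases h0 : q x = 0
        · simp [h0]
        · rw [NNReal.smul_def, norm_smul, h2 (by simpa using h0)]; simp
      rw [h5, e2] at e1
      exact_mod_cast e1.symm
    rw [hpμ, hqν]
    exact withDensity_congr_ae (heq.mono fun x hx => by simp [hx])
  · intro φ hφ hφc hφΩ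
    obtain ⟨C, hC⟩ := hφ.continuous.bounded_above_of_compact_support hφc
    have i1 : Integrable (fun x => φ x • p x • σ x) κ :=
      hpσ.bdd_smul C hφ.continuous.aestronglyMeasurable (ae_of_all _ hC)
    have i2 : Integrable (fun x => φ x • q x • τ x) κ :=
      hqτ.bdd_smul C hφ.continuous.aestronglyMeasurable (ae_of_all _ hC)
    simp only [smul_sub]
    rw [integral_sub i1 i2, sub_eq_zero]
    refine ext_inner_left ℝ fun w => ?_
    rw [← integral_inner i1, ← integral_inner i2]
    have hΦ : ContDiff ℝ 1 fun x => φ x • w := (hφ.of_le (by simp)).smul contDiff_const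
    have hΦc : HasCompactSupport fun x => φ x • w := hφc.smul_right
    have hΦΩ : tsupport (fun x => φ x • w) ⊆ Ω :=
      (tsupport_smul_subset_left φ _).trans hφΩ
    have key := (hμφ _ hΦ hΦc hΦΩ).symm.trans (hνφ _ hΦ hΦc hΦΩ)
    rw [neg_inj] at key
    rw [hpμ, integral_withDensity_eq_integral_smul hp] at key
    rw [hqν, integral_withDensity_eq_integral_smul hq] at key
    have e : ∀ (r : NNReal) (x : Euc n) (y : Euc n),
        r • ⟪φ x • w, y⟫ = ⟪w, φ x • r • y⟫ := by
      intro r x y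
      simp only [inner_smul_left, inner_smul_right, NNReal.smul_def, smul_eq_mul,
        RCLike.conj_to_real]
      ring
    simpa only [e] using key

lemma fderiv_euclidean_apply {Φ : Euc n → Euc n} (hΦ : ContDiff ℝ 1 Φ) (i : Fin n) (x v : Euc n) :
    fderiv ℝ (fun y => Φ y i) x v = fderiv ℝ Φ x v i := by
  have h : HasFDerivAt Φ (fderiv ℝ Φ x) x := (hΦ.differentiable one_ne_zero x).hasFDerivAt
  have h2 := (EuclideanSpace.proj (𝕜 := ℝ) i).hasFDerivAt.comp x h
  change fderiv ℝ (EuclideanSpace.proj (𝕜 := ℝ) i ∘ Φ) x v = _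
  rw [h2.fderiv]; rfl

lemma WeakGrad.integral_mul_vdiv {Ω : Set (Euc n)} {lam : Measure (Euc n)} {f : Euc n → ℝ}
    {G : Euc n → Euc n} (hf : Integrable f) (hG : Integrable G lam) (h : WeakGrad Ω lam f G)
    {Φ : Euc n → Euc n} (hΦ : ContDiff ℝ 1 Φ) (hΦc : HasCompactSupport Φ) (hΦΩ : tsupport Φ ⊆ Ω) :
    ∫ x in Ω, f x * vdiv n Φ x = - ∫ x, ⟪Φ x, G x⟫ ∂lam := by
  have hΦi : ∀ i, ContDiff ℝ 1 fun y => Φ y i := fun i =>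
    contDiff_euclidean.1 hΦ i
  have hsub : ∀ i, Function.support (fun y => Φ y i) ⊆ Function.support Φ := by
    intro i x hx hx'
    exact hx (by simp [hx'])
  have hΦic : ∀ i, HasCompactSupport fun y => Φ y i := fun i =>
    hΦc.mono (hsub i)
  have hΦiΩ : ∀ i, tsupport (fun y => Φ y i) ⊆ Ω := fun i => (closure_mono (hsub i)).trans hΦΩ
  rw [setIntegral_eq_integral_of_forall_compl_eq_zero]
  · have e1 : ∀ x, f x * vdiv n Φ x =
        ∑ i, f x * fderiv ℝ (fun y => Φ y i) x (EuclideanSpace.single i 1) := by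
      intro x
      rw [vdiv, Finset.mul_sum]
      exact Finset.sum_congr rfl fun i _ => by rw [fderiv_euclidean_apply hΦ]
    have e2 : ∀ x, ⟪Φ x, G x⟫ = ∑ i, Φ x i * ⟪EuclideanSpace.single i (1 : ℝ), G x⟫ := by
      intro x
      rw [PiLp.inner_apply]
      refine Finset.sum_congr rfl fun i _ => ?_
      rw [EuclideanSpace.inner_single_left]; simp [mul_comm]
    simp only [e1, e2]
    rw [integral_finsetSum, integral_finsetSum, ← Finset.sum_neg_distrib]
    · exact Finset.sum_congr rfl fun i _ => h _ (hΦi i) (hΦic i) (hΦiΩ i) _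
    · intro i _
      obtain ⟨C, hC⟩ := (hΦi i).continuous.bounded_above_of_compact_support (hΦic i)
      exact (hG.const_inner _).bdd_mul (c := C) (hΦi i).continuous.aestronglyMeasurable
        (ae_of_all _ hC)
    · intro i _
      have hc : Continuous fun x => fderiv ℝ (fun y => Φ y i) x (EuclideanSpace.single i 1) :=
        ((hΦi i).continuous_fderiv one_ne_zero).clm_apply continuous_const
      obtain ⟨C, hC⟩ := hc.bounded_above_of_compact_support ((hΦic i).fderiv_apply (𝕜 := ℝ) _)
      exact hf.mul_bdd (c := C) hc.aestronglyMeasurable (ae_of_all _ hC)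
  · intro x hx
    have : fderiv ℝ Φ x = 0 := by
      by_contra hne
      exact hx (hΦΩ (support_fderiv_subset ℝ hne))
    simp [vdiv, this]

lemma WeakGrad.isVariationPair {Ω : Set (Euc n)} (hΩ : IsOpen Ω) {lam : Measure (Euc n)}
    {f : Euc n → ℝ} {G : Euc n → Euc n} (hf : Integrable f) (hG : Integrable G lam)
    (hGm : Measurable G) (h : WeakGrad Ω lam f G) :
    IsVariationPair n f Ω ((lam.restrict Ω).withDensity fun x => ‖G x‖ₑ)
      (fun x => ‖G x‖⁻¹ • G x) := by
  refine ⟨isFiniteMeasure_withDensity_enorm hG.integrableOn, ?_,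
    (hGm.norm.inv.smul hGm).aestronglyMeasurable, ?_, ?_⟩
  · rw [withDensity_apply _ hΩ.measurableSet.compl, Measure.restrict_restrict hΩ.measurableSet.compl]
    simp
  · rw [ae_withDensity_iff hGm.enorm]
    refine ae_of_all _ fun x hx => ?_
    have : ‖G x‖ ≠ 0 := by simpa using hx
    rw [norm_smul, norm_inv, norm_norm, inv_mul_cancel₀ this]
  · intro Φ hΦ hΦc hΦΩ
    rw [h.integral_mul_vdiv hf hG hΦ hΦc hΦΩ, integral_withDensity_enorm hGm,
      setIntegral_eq_integral_of_forall_compl_eq_zero]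
    · congr 1
      refine integral_congr_ae (ae_of_all _ fun x => ?_)
      simp only [inner_smul_right]
      by_cases hy : G x = 0
      · simp [hy]
      · have := norm_ne_zero_iff.2 hy
        field_simp
    · intro x hx
      rw [image_eq_zero_of_notMem_tsupport fun hx' => hx (hΦΩ hx')]; simp

lemma WeakGrad.variation_lt_top {Ω : Set (Euc n)} {lam : Measure (Euc n)}
    {f : Euc n → ℝ} {G : Euc n → Euc n} (hf : Integrable f) (hG : Integrable G lam)
    (h : WeakGrad Ω lam f G) : variation n f Ω < ⊤ := by
  refine lt_of_le_of_lt (b := ENNReal.ofReal (∫ x, ‖G x‖ ∂lam)) ?_ ENNReal.ofReal_lt_top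
  refine iSup_le fun Φ => iSup_le fun hΦ => iSup_le fun hΦc => iSup_le fun hΦΩ => iSup_le fun h1 => ?_
  refine ENNReal.ofReal_le_ofReal ?_
  rw [h.integral_mul_vdiv hf hG hΦ hΦc hΦΩ]
  refine (neg_le_abs _).trans ?_
  rw [← Real.norm_eq_abs]
  refine (norm_integral_le_of_norm_le hG.norm (ae_of_all _ fun x => ?_))
  refine (norm_inner_le_norm _ _).trans ?_
  exact mul_le_of_le_one_left (norm_nonneg _) (h1 x)

lemma singular_decomp {Ω : Set (Euc n)} (hΩ : MeasurableSet Ω) {s : Measure (Euc n)}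
    (hs : s ⟂ₘ volume) {G : Euc n → Euc n} (hGm : Measurable G) :
    (s.restrict Ω).withDensity (fun x => ‖G x‖ₑ) =
      (((volume + s).restrict Ω).withDensity fun x => ‖G x‖ₑ).singularPart volume ∧
    volume.withDensity (Ω.indicator fun x => ‖G x‖ₑ) =
      volume.withDensity
        ((((volume + s).restrict Ω).withDensity fun x => ‖G x‖ₑ).rnDeriv volume) := by
  have h1 : (s.restrict Ω).withDensity (fun x => ‖G x‖ₑ) ⟂ₘ volume :=
    (hs.restrict Ω).withDensity
  have h2 : ((volume + s).restrict Ω).withDensity (fun x => ‖G x‖ₑ) =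
      (s.restrict Ω).withDensity (fun x => ‖G x‖ₑ) +
        volume.withDensity (Ω.indicator fun x => ‖G x‖ₑ) := by
    rw [withDensity_indicator hΩ, Measure.restrict_add, withDensity_add_measure, add_comm]
  have h3 : Measurable (Ω.indicator fun x => ‖G x‖ₑ) := hGm.enorm.indicator hΩ
  exact ⟨Measure.eq_singularPart h3 h1 h2, Measure.eq_withDensity_rnDeriv h3 h1 h2⟩

lemma absVar_eq {Ω : Set (Euc n)} (hΩ : IsOpen Ω) {s : Measure (Euc n)}
    (hs : s ⟂ₘ volume) {f : Euc n → ℝ} {G τ : Euc n → Euc n} (hGm : Measurable G)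
    (h : IsVariationPair n f Ω (((volume + s).restrict Ω).withDensity fun x => ‖G x‖ₑ) τ) :
    absVar n f Ω = ∫⁻ x in Ω, ‖G x‖ₑ := by
  have hex : ∃ p : Measure (Euc n) × (Euc n → Euc n), IsVariationPair n f Ω p.1 p.2 := ⟨(_, τ), h⟩
  rw [absVar, dif_pos hex, hex.choose_spec.unique hΩ h,
    ← (singular_decomp hΩ.measurableSet hs hGm).2, withDensity_apply _ hΩ.measurableSet,
    setLIntegral_indicator hΩ.measurableSet, Set.inter_self]

lemma cantorVar_eq {Ω : Set (Euc n)} (hΩ : IsOpen Ω) {s : Measure (Euc n)} [IsFiniteMeasure s]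
    (hs : s ⟂ₘ volume) {f : Euc n → ℝ} {G τ : Euc n → Euc n} (hGm : Measurable G)
    (h : IsVariationPair n f Ω (((volume + s).restrict Ω).withDensity fun x => ‖G x‖ₑ) τ) :
    cantorVar n f Ω = ∫⁻ x in Ω \ approxDiscontSet n f, ‖G x‖ₑ ∂s := by
  have hex : ∃ p : Measure (Euc n) × (Euc n → Euc n), IsVariationPair n f Ω p.1 p.2 := ⟨(_, τ), h⟩
  rw [cantorVar, dif_pos hex, hex.choose_spec.unique hΩ h,
    ← (singular_decomp hΩ.measurableSet hs hGm).1, withDensity_apply',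
    Measure.restrict_restrict' hΩ.measurableSet, Set.inter_eq_left.2 Set.sdiff_subset]

lemma jumpVar_eq {Ω : Set (Euc n)} (hΩ : IsOpen Ω) {s : Measure (Euc n)} [IsFiniteMeasure s]
    (hs : s ⟂ₘ volume) {f : Euc n → ℝ} {G τ : Euc n → Euc n} (hGm : Measurable G)
    (h : IsVariationPair n f Ω (((volume + s).restrict Ω).withDensity fun x => ‖G x‖ₑ) τ) :
    jumpVar n f Ω = ∫⁻ x in jumpSet n f ∩ Ω, ‖G x‖ₑ ∂s := by
  have hex : ∃ p : Measure (Euc n) × (Euc n → Euc n), IsVariationPair n f Ω p.1 p.2 := ⟨(_, τ), h⟩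
  rw [jumpVar, dif_pos hex, hex.choose_spec.unique hΩ h,
    ← (singular_decomp hΩ.measurableSet hs hGm).1, withDensity_apply',
    Measure.restrict_restrict' hΩ.measurableSet, Set.inter_assoc, Set.inter_self]

/-- The difference `h - f` tends to `0` at `x`, in the sense of essential suprema over balls. -/
def NearAt (h f : Euc n → ℝ) (x : Euc n) : Prop :=
  ∀ ε > 0, ∀ᶠ r in 𝓝[>] (0 : ℝ), ∀ᵐ y ∂volume.restrict (ball x r), |h y - f y| ≤ ε

lemma NearAt.symm {h f : Euc n → ℝ} {x : Euc n} (H : NearAt h f x) : NearAt f h x :=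
  fun ε hε => (H ε hε).mono fun r hr => hr.mono fun y hy => by rwa [abs_sub_comm]

lemma NearAt.tendsto_average {h f : Euc n → ℝ} {x : Euc n} (H : NearAt h f x)
    (hf : LocallyIntegrable f) (hh : LocallyIntegrable h) {A : ℝ → Set (Euc n)}
    (hA : ∀ r, A r ⊆ ball x r) {a : ℝ}
    (hlim : Tendsto (fun r => ⨍ y in A r, |f y - a|) (𝓝[>] 0) (𝓝 0)) :
    Tendsto (fun r => ⨍ y in A r, |h y - a|) (𝓝[>] 0) (𝓝 0) := by
  rw [Metric.tendsto_nhds] at hlim ⊢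
  intro ε hε
  filter_upwards [hlim (ε / 2) (half_pos hε), H (ε / 3) (by positivity)] with r h1 h2
  have hfin : volume (A r) ≠ ⊤ := ((measure_mono (hA r)).trans_lt measure_ball_lt_top).ne
  have hInt : ∀ g : Euc n → ℝ, LocallyIntegrable g → IntegrableOn (fun y => |g y - a|) (A r) := by
    intro g hg
    have : IntegrableOn g (A r) :=
      (hg.integrableOn_isCompact (isCompact_closedBall x r)).mono_set
        ((hA r).trans ball_subset_closedBall)
    exact (this.sub (integrableOn_const hfin)).abs
  have hnn : ∀ g : Euc n → ℝ, 0 ≤ ⨍ y in A r, |g y - a| := fun g => by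
    rw [setAverage_eq]
    exact smul_nonneg (by positivity) (integral_nonneg fun y => abs_nonneg _)
  rw [dist_zero_right, Real.norm_of_nonneg (hnn _)] at h1 ⊢
  have h3 : ⨍ y in A r, |h y - a| ≤ (⨍ y in A r, |f y - a|) + ε / 3 := by
    rw [setAverage_eq, setAverage_eq, smul_eq_mul, smul_eq_mul]
    have h4 : ∫ y in A r, |h y - a| ≤ (∫ y in A r, |f y - a|) + volume.real (A r) * (ε / 3) := by
      have e : volume.real (A r) * (ε / 3) = ∫ y in A r, ε / 3 := by simp
      rw [e, ← integral_add (hInt f hf) (integrableOn_const hfin)]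
      refine integral_mono_ae (hInt h hh) ((hInt f hf).add (integrableOn_const hfin)) ?_
      filter_upwards [ae_restrict_of_ae_restrict_of_subset (hA r) h2] with y hy
      have := abs_add_le (h y - f y) (f y - a)
      rw [sub_add_sub_cancel] at this
      linarith
    have h5 : 0 ≤ (volume.real (A r))⁻¹ := by positivity
    calc _ ≤ (volume.real (A r))⁻¹ *
          ((∫ y in A r, |f y - a|) + volume.real (A r) * (ε / 3)) :=
          mul_le_mul_of_nonneg_left h4 h5
      _ = (volume.real (A r))⁻¹ * (∫ y in A r, |f y - a|) +
          ((volume.real (A r))⁻¹ * volume.real (A r)) * (ε / 3) := by ring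
      _ ≤ _ := by
          have : (volume.real (A r))⁻¹ * volume.real (A r) ≤ 1 := inv_mul_le_one
          have := mul_le_mul_of_nonneg_right this (show 0 ≤ ε / 3 by positivity)
          linarith
  linarith

lemma NearAt.lebPt {h f : Euc n → ℝ} {x : Euc n} (H : NearAt h f x)
    (hf : LocallyIntegrable f) (hh : LocallyIntegrable h) {c : ℝ} (hc : LebPt f c x) :
    LebPt h c x :=
  H.tendsto_average hf hh (fun _ => subset_rfl) hc

lemma NearAt.approxDiscontSet_iff {h f : Euc n → ℝ} {x : Euc n} (H : NearAt h f x)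
    (hf : LocallyIntegrable f) (hh : LocallyIntegrable h) :
    x ∈ approxDiscontSet n h ↔ x ∈ approxDiscontSet n f :=
  not_congr ⟨fun ⟨c, hc⟩ => ⟨c, NearAt.lebPt H.symm hh hf hc⟩,
    fun ⟨c, hc⟩ => ⟨c, NearAt.lebPt H hf hh hc⟩⟩

lemma NearAt.mem_jumpSet {h f : Euc n → ℝ} {x : Euc n} (H : NearAt h f x)
    (hf : LocallyIntegrable f) (hh : LocallyIntegrable h) (hx : x ∈ jumpSet n f) :
    x ∈ jumpSet n h := by
  obtain ⟨ν, hν, a, b, hab, h1, h2⟩ := hx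
  exact ⟨ν, hν, a, b, hab, H.tendsto_average hf hh (fun _ => Set.sep_subset _ _) h1,
    H.tendsto_average hf hh (fun _ => Set.sep_subset _ _) h2⟩

lemma nearAt_of_eventuallyEq {h f : Euc n → ℝ} {x : Euc n} (H : ∀ᶠ y in 𝓝 x, h y = f y) :
    NearAt h f x := by
  intro ε hε
  obtain ⟨d, hd, hdb⟩ := Metric.eventually_nhds_iff_ball.1 H
  filter_upwards [Ioo_mem_nhdsGT hd] with r hr
  filter_upwards [ae_restrict_mem measurableSet_ball] with y hy
  rw [hdb y (ball_subset_ball hr.2.le hy), sub_self, abs_zero]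
  exact hε.le

/-- A Borel function which equals the approximate limit of `f` wherever that limit exists. -/
def preciseRep (f : Euc n → ℝ) (x : Euc n) : ℝ := limsup (fun j => mollify j f x) atTop

lemma measurable_preciseRep {f : Euc n → ℝ} (hf : Integrable f) : Measurable (preciseRep f) :=
  Measurable.limsup fun j => (contDiff_mollify hf.locallyIntegrable j 0).continuous.measurable

lemma LebPt.eq_preciseRep {f : Euc n → ℝ} (hf : Integrable f) {c : ℝ} {x : Euc n}
    (h : LebPt f c x) : preciseRep f x = c := (h.tendsto_mollify hf).limsup_eq

lemma lebPt_preciseRep {f : Euc n → ℝ} (hf : Integrable f) {x : Euc n}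
    (hx : x ∉ approxDiscontSet n f) : LebPt f (preciseRep f x) x := by
  simp only [approxDiscontSet, Set.mem_ofPred_eq, not_not] at hx
  obtain ⟨c, hc⟩ := hx
  have hc : LebPt f c x := hc
  rwa [hc.eq_preciseRep hf]

lemma volume_real_ball_le {x : Euc n} {r R : ℝ} (hR : R ≤ 2 * r) :
    volume.real (ball x R) ≤ 2 ^ n * volume.real (ball x r) := by
  have h2 : volume (ball x R) ≤ ENNReal.ofReal (2 ^ n) * volume (ball x r) := by
    refine (measure_mono (ball_subset_ball hR)).trans ?_
    rw [Measure.addHaar_ball_mul_of_pos _ _ two_pos, Measure.addHaar_ball_center _ x, finrank_euclideanSpace_fin]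
  rw [measureReal_def, measureReal_def, ← ENNReal.toReal_ofReal (show (0 : ℝ) ≤ 2 ^ n by positivity),
    ← ENNReal.toReal_mul]
  exact ENNReal.toReal_mono (ENNReal.mul_ne_top ENNReal.ofReal_ne_top measure_ball_lt_top.ne) h2

lemma lebPt_iff_tendsto_mollRadius {f : Euc n → ℝ} (hf : LocallyIntegrable f) {c : ℝ} {x : Euc n} :
    LebPt f c x ↔
      Tendsto (fun k => ⨍ y in ball x (mollRadius k), |f y - c|) atTop (𝓝 0) := by
  constructor
  · intro h
    refine h.comp (tendsto_nhdsWithin_iff.2 ⟨tendsto_mollRadius, ?_⟩)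
    exact Eventually.of_forall mollRadius_pos
  · intro h
    have hk : Tendsto (fun r : ℝ => ⌊r⁻¹⌋₊ - 1) (𝓝[>] 0) atTop :=
      (tendsto_sub_atTop_nat 1).comp (tendsto_nat_floor_atTop.comp tendsto_inv_nhdsGT_zero)
    have h1 := (h.comp hk).const_mul (2 ^ n)
    rw [mul_zero] at h1
    have hnn : ∀ r, 0 ≤ ⨍ y in ball x r, |f y - c| := fun r => by
      rw [setAverage_eq]
      exact smul_nonneg (by positivity) (integral_nonneg fun y => abs_nonneg _)
    refine tendsto_of_tendsto_of_tendsto_of_le_of_le' tendsto_const_nhds h1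
      (Eventually.of_forall hnn) ?_
    filter_upwards [Ioo_mem_nhdsGT (zero_lt_one (α := ℝ))] with r hr
    obtain ⟨hr0, hr1⟩ := hr
    have hinv : 1 ≤ r⁻¹ := (one_le_inv₀ hr0).2 hr1.le
    have hfl : 1 ≤ ⌊r⁻¹⌋₊ := Nat.le_floor (by simpa using hinv)
    have hρ : mollRadius (⌊r⁻¹⌋₊ - 1) = (⌊r⁻¹⌋₊ : ℝ)⁻¹ := by
      rw [mollRadius, one_div]
      congr 1
      rw [Nat.cast_sub hfl]; simp
    have hflpos : (0 : ℝ) < ⌊r⁻¹⌋₊ := by exact_mod_cast hfl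
    have hle : r ≤ mollRadius (⌊r⁻¹⌋₊ - 1) := by
      rw [hρ, le_inv_comm₀ hr0 hflpos]
      exact Nat.floor_le (inv_nonneg.2 hr0.le)
    have hge : mollRadius (⌊r⁻¹⌋₊ - 1) ≤ 2 * r := by
      rw [hρ, inv_le_comm₀ hflpos (by positivity), mul_inv]
      have h2 := Nat.lt_floor_add_one r⁻¹
      have h3 : (1 : ℝ) ≤ ⌊r⁻¹⌋₊ := by exact_mod_cast hfl
      linarith
    simp only [Function.comp]
    generalize mollRadius (⌊r⁻¹⌋₊ - 1) = R at hle hge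
    have hInt : IntegrableOn (fun y => |f y - c|) (ball x R) := by
      have : IntegrableOn f (ball x R) :=
        (hf.integrableOn_isCompact (isCompact_closedBall x R)).mono_set ball_subset_closedBall
      exact (this.sub (integrableOn_const measure_ball_lt_top.ne)).abs
    have hmono : ∫ y in ball x r, |f y - c| ≤ ∫ y in ball x R, |f y - c| :=
      setIntegral_mono_set hInt (ae_of_all _ fun y => abs_nonneg _)
        (ball_subset_ball hle).eventuallyLE
    have hv := volume_real_ball_le (x := x) hge
    have hp : ∀ t, 0 < t → 0 < volume.real (ball x t) := fun t ht => by
      rw [measureReal_def]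
      exact ENNReal.toReal_pos (measure_ball_pos volume x ht).ne' measure_ball_lt_top.ne
    rw [setAverage_eq, setAverage_eq, smul_eq_mul, smul_eq_mul, ← mul_assoc]
    refine mul_le_mul ?_ hmono (integral_nonneg fun y => abs_nonneg _) (by positivity)
    have := hp r hr0
    have := hp R (hr0.trans_le hle)
    rw [← div_eq_mul_inv, le_div_iff₀ this, inv_mul_le_iff₀ (hp r hr0)]
    linarith

lemma measurableSet_approxDiscontSet {f : Euc n → ℝ} (hf : Integrable f) (hfm : Measurable f) :
    MeasurableSet (approxDiscontSet n f) := by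
  rw [← MeasurableSet.compl_iff]
  have e : (approxDiscontSet n f)ᶜ = {x | Tendsto
      (fun k => ⨍ y in ball x (mollRadius k), |f y - preciseRep f x|) atTop (𝓝 0)} := by
    ext x
    rw [Set.mem_ofPred_eq, ← lebPt_iff_tendsto_mollRadius hf.locallyIntegrable]
    refine ⟨fun hx => lebPt_preciseRep hf hx, fun hx hx' => ?_⟩
    simp only [approxDiscontSet, Set.mem_ofPred_eq] at hx'
    exact hx' ⟨_, hx⟩
  rw [e]
  refine measurableSet_tendsto (𝓝 0) fun k => ?_
  have e2 : (fun x => ⨍ y in ball x (mollRadius k), |f y - preciseRep f x|) = fun x =>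
      (volume.real (ball (0 : Euc n) (mollRadius k)))⁻¹ *
        ∫ y, {p : Euc n × Euc n | dist p.2 p.1 < mollRadius k}.indicator
          (fun p => |f p.2 - preciseRep f p.1|) (x, y) := by
    ext x
    rw [setAverage_eq, smul_eq_mul, measureReal_def, measureReal_def, Measure.addHaar_ball_center,
      ← integral_indicator measurableSet_ball]
    rfl
  rw [e2]
  have hm : Measurable ({p : Euc n × Euc n | dist p.2 p.1 < mollRadius k}.indicator
      (fun p => |f p.2 - preciseRep f p.1|)) := by
    refine Measurable.indicator ?_ (measurableSet_lt (measurable_snd.dist measurable_fst)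
      measurable_const)
    have h1 : Measurable fun p : Euc n × Euc n => f p.2 - preciseRep f p.1 :=
      (hfm.comp measurable_snd).sub ((measurable_preciseRep hf).comp measurable_fst)
    simpa only [Real.norm_eq_abs] using h1.norm
  exact (hm.stronglyMeasurable.integral_prod_right').measurable.const_mul _

/-- A smooth bounded truncation of the identity. -/
def trunc (d : ℝ) (t : ℝ) : ℝ := d * Real.arctan (t / d)

lemma contDiff_trunc (d : ℝ) : ContDiff ℝ 1 (trunc d) :=
  contDiff_const.mul (Real.contDiff_arctan.comp (contDiff_id.div_const d))

lemma deriv_trunc {d : ℝ} (hd : 0 < d) (t : ℝ) : deriv (trunc d) t = 1 / (1 + (t / d) ^ 2) := by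
  have h : HasDerivAt (trunc d) (d * (1 / (1 + (t / d) ^ 2) * (1 / d))) t :=
    (((hasDerivAt_id t).div_const d).arctan).const_mul d
  rw [h.deriv]
  field_simp

lemma deriv_trunc_mem {d : ℝ} (hd : 0 < d) (t : ℝ) : deriv (trunc d) t ∈ Set.Icc (0 : ℝ) 1 := by
  rw [deriv_trunc hd]
  refine ⟨by positivity, ?_⟩
  rw [div_le_one (by positivity)]
  nlinarith [sq_nonneg (t / d)]

lemma deriv_trunc_zero {d : ℝ} (hd : 0 < d) : deriv (trunc d) 0 = 1 := by
  simp [deriv_trunc hd]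

lemma trunc_zero (d : ℝ) : trunc d 0 = 0 := by simp [trunc]

lemma abs_trunc_le {d : ℝ} (hd : 0 < d) (t : ℝ) : |trunc d t| ≤ 2 * d := by
  rw [trunc, abs_mul, abs_of_pos hd]
  have h1 := (Real.arctan_lt_pi_div_two (t / d)).le
  have h2 := (Real.neg_pi_div_two_lt_arctan (t / d)).le
  have h3 : |Real.arctan (t / d)| ≤ 2 := by
    rw [abs_le]; constructor <;> linarith [Real.pi_le_four]
  nlinarith

lemma exists_cutoff {K U : Set (Euc n)} (hK : IsCompact K) (hU : IsOpen U) (hKU : K ⊆ U) :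
    ∃ χ : Euc n → ℝ, ContDiff ℝ 1 χ ∧ HasCompactSupport χ ∧ tsupport χ ⊆ U ∧
      (∀ x, χ x ∈ Set.Icc (0 : ℝ) 1) ∧ ∀ x ∈ K, χ x = 1 := by
  obtain ⟨L, hL, hKL, hLU⟩ := exists_compact_between hK hU hKU
  obtain ⟨χ, h1, h0, h01⟩ := exists_contMDiffMap_one_nhds_of_subset_interior (n := 1)
    (modelWithCornersSelf ℝ (Euc n)) hK.isClosed hKL
  have hs : tsupport χ ⊆ L := closure_minimal (fun x hx => by
    by_contra hxL; exact hx (h0 x hxL)) hL.isClosed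
  exact ⟨χ, contMDiff_iff_contDiff.1 χ.contMDiff, hL.of_isClosed_subset (isClosed_tsupport _) hs,
    hs.trans hLU, h01, fun x hx => h1.self_of_nhdsSet x hx⟩

section Split
variable {s : Measure (Euc n)} {N : Set (Euc n)}

lemma restrict_compl_add (h0 : volume N = 0) (hs : s Nᶜ = 0) :
    ((volume : Measure (Euc n)) + s).restrict Nᶜ = volume := by
  rw [Measure.restrict_add, Measure.restrict_eq_zero.2 hs, add_zero]
  exact Measure.restrict_eq_self_of_ae_mem (compl_mem_ae_iff.2 h0)

lemma restrict_add_null (h0 : volume N = 0) (hs : s Nᶜ = 0) :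
    ((volume : Measure (Euc n)) + s).restrict N = s := by
  rw [Measure.restrict_add, Measure.restrict_eq_zero.2 h0, zero_add]
  exact Measure.restrict_eq_self_of_ae_mem (mem_ae_iff.2 hs)

end Split

/-- An integrable function together with a density of its gradient with respect to
`volume + s`. -/
structure IsState (Ω : Set (Euc n)) (s : Measure (Euc n)) (f : Euc n → ℝ) (G : Euc n → Euc n) :
    Prop where
  meas : Measurable f
  int : Integrable f
  gmeas : Measurable G
  gint : Integrable G (volume + s)
  grad : WeakGrad Ω (volume + s) f G

/-- The absolutely continuous part added to the gradient when gluing. -/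
def glueGrad (χ g f : Euc n → ℝ) (T : ℝ → ℝ) (x : Euc n) : Euc n :=
  (χ x * deriv T (g x - f x)) • gradient g x + T (g x - f x) • gradient χ x

/-- The function `f + χ T(g - f)`, equal to `f` off the support of `χ`. -/
def glueFun (χ g f : Euc n → ℝ) (T : ℝ → ℝ) (x : Euc n) : ℝ := f x + χ x * T (g x - f x)

lemma continuous_gradient {g : Euc n → ℝ} (hg : ContDiff ℝ 1 g) : Continuous (gradient g) :=
  (InnerProductSpace.toDual ℝ (Euc n)).symm.continuous.comp (hg.continuous_fderiv one_ne_zero)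

lemma hasCompactSupport_gradient {g : Euc n → ℝ} (hg : HasCompactSupport g) :
    HasCompactSupport (gradient g) :=
  (hg.fderiv (𝕜 := ℝ)).comp_left (g := (InnerProductSpace.toDual ℝ (Euc n)).symm) (map_zero _)

section Glue
variable {χ g f : Euc n → ℝ} {T : ℝ → ℝ} {M : ℝ}

lemma measurable_glueGrad (hχ : ContDiff ℝ 1 χ) (hg : ContDiff ℝ 1 g) (hT : ContDiff ℝ 1 T)
    (hf : Measurable f) : Measurable (glueGrad χ g f T) := by
  have h1 := hT.continuous_deriv le_rfl |>.measurable.comp (hg.continuous.measurable.sub hf)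
  have h2 := hT.continuous.measurable.comp (hg.continuous.measurable.sub hf)
  exact ((hχ.continuous.measurable.mul h1).smul (continuous_gradient hg).measurable).add
    (h2.smul (continuous_gradient hχ).measurable)

lemma norm_glueGrad_le (hχ01 : ∀ x, χ x ∈ Set.Icc (0 : ℝ) 1)
    (hT' : ∀ t, deriv T t ∈ Set.Icc (0 : ℝ) 1) (x : Euc n) :
    ‖glueGrad χ g f T x‖ ≤ χ x * ‖gradient g x‖ + |T (g x - f x)| * ‖gradient χ x‖ := by
  refine (norm_add_le _ _).trans ?_
  rw [norm_smul, norm_smul, norm_mul, Real.norm_of_nonneg (hχ01 x).1,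
    Real.norm_of_nonneg (hT' _).1, Real.norm_eq_abs]
  gcongr
  exact mul_le_of_le_one_right (hχ01 x).1 (hT' _).2

lemma integrable_glueGrad (hχ : ContDiff ℝ 1 χ) (hχc : HasCompactSupport χ)
    (hχ01 : ∀ x, χ x ∈ Set.Icc (0 : ℝ) 1) (hg : ContDiff ℝ 1 g) (hT : ContDiff ℝ 1 T)
    (hT' : ∀ t, deriv T t ∈ Set.Icc (0 : ℝ) 1) (hM : ∀ t, |T t| ≤ M) (hf : Measurable f) :
    Integrable (glueGrad χ g f T) := by
  have hb : Integrable fun x => χ x * ‖gradient g x‖ + M * ‖gradient χ x‖ := by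
    refine Integrable.add ?_ ?_
    · exact (hχ.continuous.mul (continuous_gradient hg).norm).integrable_of_hasCompactSupport
        hχc.mul_right
    · exact ((continuous_gradient hχ).integrable_of_hasCompactSupport
        (hasCompactSupport_gradient hχc)).norm.const_mul M
  refine hb.mono' (measurable_glueGrad hχ hg hT hf).aestronglyMeasurable (ae_of_all _ fun x => ?_)
  refine (norm_glueGrad_le hχ01 hT' x).trans ?_
  gcongr
  exact hM _

lemma IsState.glue {Ω : Set (Euc n)} {s : Measure (Euc n)}
    {N : Set (Euc n)} (hN : MeasurableSet N) (h0 : volume N = 0) (hs : s Nᶜ = 0)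
    {G : Euc n → Euc n} (S : IsState Ω s f G)
    (hχ : ContDiff ℝ 1 χ) (hχc : HasCompactSupport χ) (hχΩ : tsupport χ ⊆ Ω)
    (hχ01 : ∀ x, χ x ∈ Set.Icc (0 : ℝ) 1) (hg : ContDiff ℝ 1 g) (hT : ContDiff ℝ 1 T)
    (hT' : ∀ t, deriv T t ∈ Set.Icc (0 : ℝ) 1) (hM : ∀ t, |T t| ≤ M)
    {b : Euc n → ℝ} (hbm : Measurable b) (hb : ∀ x, b x ∈ Set.Icc (0 : ℝ) 1)
    (hchain : ∀ φ : Euc n → ℝ, ContDiff ℝ 1 φ → HasCompactSupport φ → tsupport φ ⊆ Ω →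
      ∀ v : Euc n, ∫ x, T (g x - f x) * fderiv ℝ φ x v =
          - ((∫ x, φ x * (deriv T (g x - f x) * fderiv ℝ g x v)) -
            ∫ y, φ y * (b y * ⟪v, G y⟫) ∂(volume + s))) :
    IsState Ω s (glueFun χ g f T)
      (fun x => (1 - χ x * b x) • G x + Nᶜ.indicator (glueGrad χ g f T) x) := by
  have hTm : Measurable fun x => T (g x - f x) :=
    hT.continuous.measurable.comp (hg.continuous.measurable.sub S.meas)
  have hT'm : Measurable fun x => deriv T (g x - f x) :=
    (hT.continuous_deriv le_rfl).measurable.comp (hg.continuous.measurable.sub S.meas)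
  have hχi : Integrable χ := hχ.continuous.integrable_of_hasCompactSupport hχc
  have hR := integrable_glueGrad hχ hχc hχ01 hg hT hT' hM S.meas
  have hRm := measurable_glueGrad hχ hg hT S.meas
  have hRi : Integrable (Nᶜ.indicator (glueGrad χ g f T)) (volume + s) := by
    rw [integrable_indicator_iff hN.compl, IntegrableOn, restrict_compl_add h0 hs]
    exact hR
  have hcm : Measurable fun x => 1 - χ x * b x :=
    measurable_const.sub (hχ.continuous.measurable.mul hbm)
  have hGi : Integrable (fun x => (1 - χ x * b x) • G x) (volume + s) := by
    refine S.gint.bdd_smul 1 hcm.aestronglyMeasurable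
      (ae_of_all _ fun x => ?_)
    rw [Real.norm_eq_abs, abs_le]
    constructor <;> nlinarith [(hχ01 x).1, (hχ01 x).2, (hb x).1, (hb x).2,
      mul_nonneg (hχ01 x).1 (hb x).1, mul_le_one₀ (hχ01 x).2 (hb x).1 (hb x).2]
  have hχT : Integrable fun x => χ x * T (g x - f x) :=
    hχi.mul_bdd (c := M) hTm.aestronglyMeasurable (ae_of_all _ fun x => hM _)
  refine ⟨S.meas.add (hχ.continuous.measurable.mul hTm), S.int.add hχT,
    (hcm.smul S.gmeas).add (hRm.indicator hN.compl), hGi.add hRi, ?_⟩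
  intro φ hφ hφc hφΩ v
  have hφ' : Continuous fun x => fderiv ℝ φ x v :=
    (hφ.continuous_fderiv one_ne_zero).clm_apply continuous_const
  have hφsupp : HasCompactSupport fun x => fderiv ℝ φ x v := hφc.fderiv_apply (𝕜 := ℝ) v
  have hχ' : Continuous fun x => fderiv ℝ χ x v :=
    (hχ.continuous_fderiv one_ne_zero).clm_apply continuous_const
  have hg' : Continuous fun x => fderiv ℝ g x v :=
    (hg.continuous_fderiv one_ne_zero).clm_apply continuous_const
  obtain ⟨C, hC⟩ := hφ.continuous.bounded_above_of_compact_support hφc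
  obtain ⟨C', hC'⟩ := hφ'.bounded_above_of_compact_support hφsupp
  have i1 : Integrable fun x => f x * fderiv ℝ φ x v :=
    S.int.mul_bdd (c := C') hφ'.aestronglyMeasurable (ae_of_all _ hC')
  have i2 : Integrable fun x => χ x * T (g x - f x) * fderiv ℝ φ x v :=
    hχT.mul_bdd (c := C') hφ'.aestronglyMeasurable (ae_of_all _ hC')
  have e1 : ∫ x, glueFun χ g f T x * fderiv ℝ φ x v =
      (∫ x, f x * fderiv ℝ φ x v) + ∫ x, χ x * T (g x - f x) * fderiv ℝ φ x v := by
    rw [← integral_add i1 i2]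
    refine integral_congr_ae (ae_of_all _ fun x => ?_)
    simp only [glueFun]; ring
  have hχφ : ContDiff ℝ 1 fun x => χ x * φ x := hχ.mul hφ
  have hfd : ∀ x, fderiv ℝ (fun x => χ x * φ x) x v
      = χ x * fderiv ℝ φ x v + φ x * fderiv ℝ χ x v := fun x => by
    rw [fderiv_fun_mul (hχ.differentiable one_ne_zero x) (hφ.differentiable one_ne_zero x)]
    simp
  have i3 : Integrable fun x => T (g x - f x) * (φ x * fderiv ℝ χ x v) :=
    ((hφ.continuous.mul hχ').integrable_of_hasCompactSupport hφc.mul_right).bdd_mul (c := M)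
      hTm.aestronglyMeasurable (ae_of_all _ fun x => hM _)
  have e2 : ∫ x, χ x * T (g x - f x) * fderiv ℝ φ x v =
      (∫ x, T (g x - f x) * fderiv ℝ (fun x => χ x * φ x) x v) -
        ∫ x, T (g x - f x) * (φ x * fderiv ℝ χ x v) := by
    rw [← integral_sub (f := fun x => T (g x - f x) * fderiv ℝ (fun x => χ x * φ x) x v) ?_ i3]
    · refine integral_congr_ae (ae_of_all _ fun x => ?_)
      simp only [hfd]; ring
    · refine (i2.add i3).congr (ae_of_all _ fun x => ?_)
      simp only [hfd, Pi.add_apply]; ring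
  have e3 := hchain (fun x => χ x * φ x) hχφ hφc.mul_left
    ((tsupport_mul_subset_left).trans hχΩ) v
  have j1 : Integrable (fun x => φ x * ⟪v, G x⟫) (volume + s) :=
    (S.gint.const_inner v).bdd_mul (c := C) hφ.continuous.aestronglyMeasurable (ae_of_all _ hC)
  have j2 : Integrable (fun x => χ x * φ x * (b x * ⟪v, G x⟫)) (volume + s) := by
    refine (j1.bdd_mul (c := 1) (f := fun x => χ x * b x)
      (hχ.continuous.measurable.mul hbm).aestronglyMeasurable (ae_of_all _ fun x => ?_)).congr
      (ae_of_all _ fun x => ?_)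
    · rw [Real.norm_of_nonneg (mul_nonneg (hχ01 x).1 (hb x).1)]
      exact mul_le_one₀ (hχ01 x).2 (hb x).1 (hb x).2
    · simp only; ring
  have j3 : Integrable (fun x => φ x * ⟪v, Nᶜ.indicator (glueGrad χ g f T) x⟫) (volume + s) :=
    (hRi.const_inner v).bdd_mul (c := C) hφ.continuous.aestronglyMeasurable (ae_of_all _ hC)
  have e4 : ∫ x, φ x * ⟪v, (1 - χ x * b x) • G x + Nᶜ.indicator (glueGrad χ g f T) x⟫
        ∂(volume + s) =
      (∫ x, φ x * ⟪v, G x⟫ ∂(volume + s)) - (∫ x, χ x * φ x * (b x * ⟪v, G x⟫) ∂(volume + s))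
        + ∫ x, φ x * ⟪v, Nᶜ.indicator (glueGrad χ g f T) x⟫ ∂(volume + s) := by
    have j12 : Integrable (fun x => φ x * ⟪v, G x⟫ - χ x * φ x * (b x * ⟪v, G x⟫))
      (volume + s) := j1.sub j2
    rw [← integral_sub j1 j2, ← integral_add j12 j3]
    refine integral_congr_ae (ae_of_all _ fun x => ?_)
    simp only [inner_add_right, inner_smul_right]; ring
  have j4 : Integrable fun x => χ x * φ x * (deriv T (g x - f x) * fderiv ℝ g x v) := by
    refine (((hχφ.continuous.mul hg').integrable_of_hasCompactSupport
      (hφc.mul_left.mul_right)).bdd_mul (c := 1)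
      (f := fun x => deriv T (g x - f x)) hT'm.aestronglyMeasurable
      (ae_of_all _ fun x => ?_)).congr (ae_of_all _ fun x => ?_)
    · rw [Real.norm_of_nonneg (hT' _).1]; exact (hT' _).2
    · simp only [Pi.mul_apply]; ring
  have e5 : ∫ x, φ x * ⟪v, Nᶜ.indicator (glueGrad χ g f T) x⟫ ∂(volume + s) =
      (∫ x, χ x * φ x * (deriv T (g x - f x) * fderiv ℝ g x v)) +
        ∫ x, T (g x - f x) * (φ x * fderiv ℝ χ x v) := by
    have : ∀ x, φ x * ⟪v, Nᶜ.indicator (glueGrad χ g f T) x⟫ =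
        Nᶜ.indicator (fun x => φ x * ⟪v, glueGrad χ g f T x⟫) x := fun x => by
      by_cases hx : x ∈ Nᶜ
      · simp [Set.indicator_of_mem hx]
      · simp [Set.indicator_of_notMem hx]
    simp only [this]
    rw [integral_indicator hN.compl, restrict_compl_add h0 hs, ← integral_add j4 i3]
    refine integral_congr_ae (ae_of_all _ fun x => ?_)
    simp only [glueGrad, inner_add_right, inner_smul_right]
    rw [real_inner_comm, real_inner_comm (gradient χ x), inner_gradient_left, inner_gradient_left]
    ring
  rw [e1, e2, e3, e4, e5, S.grad φ hφ hφc hφΩ v]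
  ring

end Glue

lemma tendsto_lintegral_trunc_mul {f : Euc n → ℝ} (hf : Integrable f) (hfm : Measurable f)
    {d : ℝ} (hd : 0 < d) {F : Type*} [NormedAddCommGroup F] {κ : Euc n → F}
    (hκ : Integrable κ) :
    Tendsto (fun j => ∫⁻ x, ‖trunc d (mollify j f x - f x)‖ₑ * ‖κ x‖ₑ) atTop (𝓝 0) := by
  have h0 : (0 : ℝ≥0∞) = ∫⁻ _ : Euc n, 0 := by simp
  rw [h0]
  refine tendsto_lintegral_of_dominated_convergence' (fun x => ENNReal.ofReal (2 * d) * ‖κ x‖ₑ)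
    (fun j => ?_) (fun j => ae_of_all _ fun x => ?_) ?_ ?_
  · refine AEMeasurable.mul ?_ hκ.1.enorm
    exact ((contDiff_trunc d).continuous.measurable.comp
      ((contDiff_mollify hf.locallyIntegrable j 0).continuous.measurable.sub
        hfm)).enorm.aemeasurable
  · simp only [Real.enorm_eq_ofReal_abs (trunc _ _)]
    gcongr
    exact abs_trunc_le hd _
  · rw [lintegral_const_mul'' _ hκ.1.enorm]
    exact ENNReal.mul_ne_top ENNReal.ofReal_ne_top hκ.2.ne
  · filter_upwards [ae_tendsto_mollify hf] with x hx
    have h1 : Tendsto (fun j => trunc d (mollify j f x - f x)) atTop (𝓝 0) := by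
      have := ((contDiff_trunc d).continuous.tendsto _).comp (hx.sub_const (f x))
      rwa [sub_self, trunc_zero] at this
    have h2 := ENNReal.Tendsto.mul_const (b := ‖κ x‖ₑ) h1.enorm (Or.inr enorm_ne_top)
    simpa using h2

lemma tendsto_setLIntegral_one_sub {f : Euc n → ℝ} (hf : Integrable f)
    {d : ℝ} (hd : 0 < d) {m : Measure (Euc n)} [IsFiniteMeasure m] {K : Set (Euc n)}
    (hK : MeasurableSet K) (hL : ∀ x ∈ K, LebPt f (preciseRep f x) x) :
    Tendsto (fun j => ∫⁻ x in K,
      ENNReal.ofReal (1 - deriv (trunc d) (mollify j f x - preciseRep f x)) ∂m) atTop (𝓝 0) := by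
  have h0 : (0 : ℝ≥0∞) = ∫⁻ _ in K, 0 ∂m := by simp
  have hc : Continuous (deriv (trunc d)) := (contDiff_trunc d).continuous_deriv le_rfl
  rw [h0]
  refine tendsto_lintegral_of_dominated_convergence (fun _ => 1)
    (fun j => ?_) (fun j => ae_of_all _ fun x => ?_) ?_ ?_
  · exact (measurable_const.sub (hc.measurable.comp
      ((contDiff_mollify hf.locallyIntegrable j 0).continuous.measurable.sub
        (measurable_preciseRep hf)))).ennreal_ofReal
  · rw [← ENNReal.ofReal_one]
    exact ENNReal.ofReal_le_ofReal (by linarith [(deriv_trunc_mem hd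
      (mollify j f x - preciseRep f x)).1])
  · simp
  · filter_upwards [ae_restrict_mem hK] with x hx
    have h1 := ((hL x hx).tendsto_mollify hf).sub_const (preciseRep f x)
    have h2 := ENNReal.tendsto_ofReal (((hc.tendsto _).comp h1).const_sub 1)
    simpa [deriv_trunc_zero hd] using h2

lemma enorm_gradient (g : Euc n → ℝ) (x : Euc n) : ‖gradient g x‖ₑ = ‖fderiv ℝ g x‖ₑ := by
  rw [← ofReal_norm, ← ofReal_norm]
  congr 1
  exact (InnerProductSpace.toDual ℝ (Euc n)).symm.norm_map _

lemma setLIntegral_withDensity_compact {f : Euc n → ℝ≥0∞} {μ : Measure (Euc n)}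
    (hf : Measurable f) {A : Set (Euc n)} (hA : MeasurableSet A) {k : Euc n → ℝ≥0∞}
    (hk : Measurable k) :
    ∫⁻ x in A, k x ∂(μ.withDensity f) = ∫⁻ x in A, f x * k x ∂μ := by
  rw [restrict_withDensity hA, lintegral_withDensity_eq_lintegral_mul _ hf hk]
  rfl

lemma IsState.step {Ω : Set (Euc n)} (hΩ : IsOpen Ω) {s : Measure (Euc n)} [IsFiniteMeasure s]
    {N : Set (Euc n)} (hN : MeasurableSet N) (h0 : volume N = 0) (hs : s Nᶜ = 0)
    {f : Euc n → ℝ} {G : Euc n → Euc n} (S : IsState Ω s f G) {δ : ℝ} (hδ : 0 < δ)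
    {η : ℝ≥0∞} (hη : η ≠ 0) :
    ∃ (f₁ : Euc n → ℝ) (G₁ : Euc n → Euc n) (C : Set (Euc n)), IsState Ω s f₁ G₁ ∧ IsClosed C ∧
      (∀ x, |f₁ x - f x| ≤ δ) ∧ (∀ x ∉ C, f₁ x = f x) ∧ ∫⁻ x, ‖f₁ x - f x‖ₑ ≤ η ∧
      (∀ᵐ x ∂s, ‖G₁ x‖ₑ ≤ ‖G x‖ₑ) ∧ ∫⁻ x in C, ‖G₁ x‖ₑ ∂s ≤ η ∧
      ∫⁻ x in (Ω \ approxDiscontSet n f) \ C, ‖G x‖ₑ ∂s ≤ η ∧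
      ∫⁻ x, ‖G₁ x‖ₑ ≤ (∫⁻ x, ‖G x‖ₑ) + (∫⁻ x in Ω \ approxDiscontSet n f, ‖G x‖ₑ ∂s) + η ∧
      ∫⁻ x, ‖G₁ x - G x‖ₑ ∂(volume + s) ≤
        2 * (∫⁻ x in Ω \ approxDiscontSet n f, ‖G x‖ₑ ∂s) + η := by
  obtain ⟨e, he0, he⟩ : ∃ e : ℝ≥0∞, e ≠ 0 ∧ 4 * e = η :=
    ⟨η / 4, ENNReal.div_ne_zero.2 ⟨hη, by simp⟩, ENNReal.mul_div_cancel (by simp) (by simp)⟩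
  have he' : 0 < e := pos_iff_ne_zero.2 he0
  have hle1 : e ≤ η := by
    rw [← he]; exact le_mul_of_one_le_left (zero_le) (by norm_num)
  have hle2 : e + e ≤ η := by
    rw [← he, ← two_mul]; gcongr; norm_num
  have hle3 : e + e + e ≤ η := by
    rw [← he, show e + e + e = 3 * e by ring]; gcongr; norm_num
  set m : Measure (Euc n) := (volume + s).withDensity fun x => ‖G x‖ₑ with hm
  have : IsFiniteMeasure m := isFiniteMeasure_withDensity_enorm S.gint
  have hGe : Measurable fun x => ‖G x‖ₑ := S.gmeas.enorm
  set D : Set (Euc n) := Ω \ approxDiscontSet n f with hD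
  have hDm : MeasurableSet D :=
    hΩ.measurableSet.diff (measurableSet_approxDiscontSet S.int S.meas)
  have hsN : ∀ᵐ x ∂s, x ∈ N := mem_ae_iff.2 hs
  have hvN : ∀ᵐ x ∂(volume : Measure (Euc n)), x ∉ N := compl_mem_ae_iff.2 h0
  -- the mass of Cantor type
  have hsm : ∀ A : Set (Euc n), MeasurableSet A → ∫⁻ x in A, ‖G x‖ₑ ∂s ≤ m A := fun A hA => by
    rw [hm, withDensity_apply _ hA, Measure.restrict_add, lintegral_add_measure]
    exact le_add_self
  have hmN : ∀ A : Set (Euc n), MeasurableSet A → m (A ∩ N) = ∫⁻ x in A, ‖G x‖ₑ ∂s := fun A hA => by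
    rw [hm, withDensity_apply _ (hA.inter hN), ← Measure.restrict_restrict hA,
      restrict_add_null h0 hs]
  set c := ∫⁻ x in D, ‖G x‖ₑ ∂s with hc
  obtain ⟨K, hKD, hK, hKm⟩ := (hDm.inter hN).exists_isCompact_sdiff_lt
    (measure_ne_top m _) he0
  obtain ⟨U, hKU, hU, hUΩ, hUm⟩ : ∃ U, K ⊆ U ∧ IsOpen U ∧ U ⊆ Ω ∧ m U < m K + e := by
    obtain ⟨V, hKV, hV, hVm⟩ := K.exists_isOpen_lt_add (μ := m) (measure_ne_top m K) he0
    exact ⟨V ∩ Ω, Set.subset_inter hKV fun x hx => (hKD hx).1.1, hV.inter hΩ,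
      Set.inter_subset_right, (measure_mono Set.inter_subset_left).trans_lt hVm⟩
  have hKc : m K ≤ c := (measure_mono hKD).trans (hmN D hDm).le
  have hUK : m (U \ K) ≤ e := by
    rw [measure_sdiff hKU hK.measurableSet.nullMeasurableSet (measure_ne_top m K)]
    exact tsub_le_iff_left.2 hUm.le
  obtain ⟨χ, hχ, hχc, hχU, hχ01, hχ1⟩ := exists_cutoff hK hU hKU
  set d := δ / 2 with hd
  have hd0 : 0 < d := by positivity
  have hLeb : ∀ x ∈ D, LebPt f (preciseRep f x) x := fun x hx => lebPt_preciseRep S.int hx.2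
  have hχi : Integrable χ := hχ.continuous.integrable_of_hasCompactSupport hχc
  have hχgi : Integrable (gradient χ) := (continuous_gradient hχ).integrable_of_hasCompactSupport
        (hasCompactSupport_gradient hχc)
  obtain ⟨j, hj1, hj2, hj3, hj4⟩ := ((eventually_closedBall_mollRadius_subset
    hχc hU hχU).and (((tendsto_lintegral_trunc_mul S.int S.meas hd0 hχgi).eventually_le_const
      he').and (((tendsto_lintegral_trunc_mul S.int S.meas hd0 hχi).eventually_le_const he').and
      ((tendsto_setLIntegral_one_sub S.int hd0 (m := m) hK.measurableSet
        fun x hx => hLeb x (hKD hx).1).eventually_le_const he')))).exists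
  set g := mollify j f with hg
  have hgd : ContDiff ℝ 1 g := contDiff_mollify S.int.locallyIntegrable j 1
  have hT := contDiff_trunc d
  have hT' := deriv_trunc_mem hd0
  have hM := abs_trunc_le hd0
  obtain ⟨b, hbm, hb, hchain, hbA⟩ := exists_chain hΩ S.int S.gint S.gmeas S.grad hgd hT hT' hM
  have hbK : ∀ᵐ y ∂m.restrict K, b y = deriv (trunc d) (g y - preciseRep f y) :=
    hbA K (preciseRep f) hK.measurableSet fun x hx => hLeb x (hKD hx).1
  have hcoef : ∀ x, 1 - χ x * b x ∈ Set.Icc (0 : ℝ) 1 := fun x =>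
    ⟨by linarith [mul_le_one₀ (hχ01 x).2 (hb x).1 (hb x).2],
      by linarith [mul_nonneg (hχ01 x).1 (hb x).1]⟩
  set R := glueGrad χ g f (trunc d) with hR
  have hRm : Measurable R := measurable_glueGrad hχ hgd hT S.meas
  -- bound for the new absolutely continuous part
  have hRb : ∫⁻ x, ‖R x‖ₑ ≤ c + e + e := by
    have h1 : ∀ x, ‖R x‖ₑ ≤ (tsupport χ).indicator (fun x => ‖fderiv ℝ g x‖ₑ) x +
        ‖trunc d (g x - f x)‖ₑ * ‖gradient χ x‖ₑ := fun x => by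
      refine (enorm_add_le _ _).trans (add_le_add ?_ (enorm_smul _ _).le)
      rw [enorm_smul, enorm_gradient]
      by_cases hx : x ∈ tsupport χ
      · rw [Set.indicator_of_mem hx]
        refine mul_le_of_le_one_left zero_le ?_
        rw [Real.enorm_of_nonneg (mul_nonneg (hχ01 x).1 (hT' _).1)]
        exact ENNReal.ofReal_le_one.2 (mul_le_one₀ (hχ01 x).2 (hT' _).1 (hT' _).2)
      · simp [image_eq_zero_of_notMem_tsupport hx]
    have h2 := lintegral_fderiv_mollify_le S.int S.gint S.grad
      (isClosed_tsupport χ).measurableSet hU.measurableSet hUΩ hj1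
    have h3 : ∫⁻ y in U, ‖G y‖ₑ ∂(volume + s) ≤ c + e := by
      rw [← withDensity_apply _ hU.measurableSet]
      exact hUm.le.trans (by gcongr)
    calc ∫⁻ x, ‖R x‖ₑ ≤ ∫⁻ x, ((tsupport χ).indicator (fun x => ‖fderiv ℝ g x‖ₑ) x +
        ‖trunc d (g x - f x)‖ₑ * ‖gradient χ x‖ₑ) := lintegral_mono h1
      _ = (∫⁻ x in tsupport χ, ‖fderiv ℝ g x‖ₑ) +
          ∫⁻ x, ‖trunc d (g x - f x)‖ₑ * ‖gradient χ x‖ₑ := by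
        rw [lintegral_add_left, lintegral_indicator (isClosed_tsupport χ).measurableSet]
        exact ((hgd.continuous_fderiv one_ne_zero).measurable.enorm).indicator
          (isClosed_tsupport χ).measurableSet
      _ ≤ c + e + e := add_le_add (h2.trans h3) hj2
  have hG1N : ∀ x ∈ N, ‖(1 - χ x * b x) • G x + Nᶜ.indicator R x‖ₑ =
      ‖G x‖ₑ * ENNReal.ofReal (1 - χ x * b x) := fun x hx => by
    rw [Set.indicator_of_notMem (Set.notMem_compl_iff.2 hx), add_zero, enorm_smul,
      Real.enorm_of_nonneg (hcoef x).1, mul_comm]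
  refine ⟨glueFun χ g f (trunc d), fun x => (1 - χ x * b x) • G x + Nᶜ.indicator R x, tsupport χ,
    S.glue hN h0 hs hχ hχc (hχU.trans hUΩ) hχ01 hgd hT hT' hM hbm hb hchain,
    isClosed_tsupport χ, fun x => ?_, fun x hx => ?_, ?_, ?_, ?_, ?_, ?_, ?_⟩
  · rw [glueFun, add_sub_cancel_left, abs_mul, abs_of_nonneg (hχ01 x).1]
    refine (mul_le_of_le_one_left (abs_nonneg _) (hχ01 x).2).trans ((hM _).trans ?_)
    rw [hd]; linarith
  · rw [glueFun, image_eq_zero_of_notMem_tsupport hx, zero_mul, add_zero]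
  · refine le_trans (le_of_eq (lintegral_congr fun x => ?_)) (hj3.trans hle1)
    rw [glueFun, add_sub_cancel_left, enorm_mul, mul_comm]
  · filter_upwards [hsN] with x hx
    rw [hG1N x hx]
    exact mul_le_of_le_one_right zero_le (ENNReal.ofReal_le_one.2 (hcoef x).2)
  · -- mass on the modified set
    have h1 : ∫⁻ x in tsupport χ, ‖(1 - χ x * b x) • G x + Nᶜ.indicator R x‖ₑ ∂s =
        ∫⁻ x in tsupport χ, ‖G x‖ₑ * ENNReal.ofReal (1 - χ x * b x) ∂s := by
      refine lintegral_congr_ae (ae_restrict_of_ae ?_)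
      filter_upwards [hsN] with x hx using hG1N x hx
    have h2 : ∫⁻ x in K, ‖G x‖ₑ * ENNReal.ofReal (1 - χ x * b x) ∂s ≤ e := by
      calc ∫⁻ x in K, ‖G x‖ₑ * ENNReal.ofReal (1 - χ x * b x) ∂s
          = ∫⁻ x in K, ‖G x‖ₑ * ENNReal.ofReal (1 - b x) ∂s :=
            setLIntegral_congr_fun hK.measurableSet fun x hx => by simp only [hχ1 x hx, one_mul]
        _ ≤ ∫⁻ x in K, ‖G x‖ₑ * ENNReal.ofReal (1 - b x) ∂(volume + s) := by
            rw [Measure.restrict_add, lintegral_add_measure]; exact le_add_self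
        _ = ∫⁻ x in K, ENNReal.ofReal (1 - b x) ∂m :=
            (setLIntegral_withDensity_compact hGe hK.measurableSet
              (measurable_const.sub hbm).ennreal_ofReal).symm
        _ = ∫⁻ x in K, ENNReal.ofReal (1 - deriv (trunc d) (g x - preciseRep f x)) ∂m :=
            lintegral_congr_ae (by filter_upwards [hbK] with x hx; rw [hx])
        _ ≤ e := hj4
    rw [h1]
    calc ∫⁻ x in tsupport χ, ‖G x‖ₑ * ENNReal.ofReal (1 - χ x * b x) ∂s
        ≤ ∫⁻ x in K ∪ (U \ K), ‖G x‖ₑ * ENNReal.ofReal (1 - χ x * b x) ∂s :=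
          lintegral_mono_set (by rw [Set.union_sdiff_self]; exact hχU.trans Set.subset_union_right)
      _ ≤ (∫⁻ x in K, ‖G x‖ₑ * ENNReal.ofReal (1 - χ x * b x) ∂s) +
          ∫⁻ x in U \ K, ‖G x‖ₑ * ENNReal.ofReal (1 - χ x * b x) ∂s := lintegral_union_le _ _ _
      _ ≤ e + ∫⁻ x in U \ K, ‖G x‖ₑ ∂s := by
          gcongr with x
          exact mul_le_of_le_one_right zero_le (ENNReal.ofReal_le_one.2 (hcoef x).2)
      _ ≤ e + e := by gcongr; exact (hsm _ (hU.measurableSet.diff hK.measurableSet)).trans hUK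
      _ ≤ η := hle2
  · have hKC : K ⊆ tsupport χ := fun x hx => subset_tsupport _ (by simp [hχ1 x hx])
    calc ∫⁻ x in D \ tsupport χ, ‖G x‖ₑ ∂s ≤ ∫⁻ x in D \ K, ‖G x‖ₑ ∂s :=
          lintegral_mono_set (Set.sdiff_subset_sdiff_right hKC)
      _ = m (D \ K ∩ N) := (hmN _ (hDm.diff hK.measurableSet)).symm
      _ = m ((D ∩ N) \ K) := by congr 1; ext x; simp only [Set.mem_inter_iff, Set.mem_sdiff]; tauto
      _ ≤ η := hKm.le.trans hle1
  · calc ∫⁻ x, ‖(1 - χ x * b x) • G x + Nᶜ.indicator R x‖ₑ ≤ ∫⁻ x, (‖G x‖ₑ + ‖R x‖ₑ) := by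
          refine lintegral_mono fun x => (enorm_add_le _ _).trans (add_le_add ?_ ?_)
          · rw [enorm_smul, Real.enorm_of_nonneg (hcoef x).1]
            exact mul_le_of_le_one_left zero_le (ENNReal.ofReal_le_one.2 (hcoef x).2)
          · exact enorm_indicator_le_enorm_self _ _
      _ = (∫⁻ x, ‖G x‖ₑ) + ∫⁻ x, ‖R x‖ₑ := lintegral_add_left hGe _
      _ ≤ (∫⁻ x, ‖G x‖ₑ) + (c + e + e) := by gcongr
      _ = (∫⁻ x, ‖G x‖ₑ) + c + (e + e) := by ring
      _ ≤ _ := by gcongr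
  · have h1 : ∀ x, ‖(1 - χ x * b x) • G x + Nᶜ.indicator R x - G x‖ₑ ≤
        U.indicator (fun x => ‖G x‖ₑ) x + Nᶜ.indicator (fun x => ‖R x‖ₑ) x := fun x => by
      have : (1 - χ x * b x) • G x + Nᶜ.indicator R x - G x =
          -((χ x * b x) • G x) + Nᶜ.indicator R x := by module
      rw [this]
      refine (enorm_add_le _ _).trans (add_le_add ?_ ?_)
      · rw [enorm_neg, enorm_smul, Real.enorm_of_nonneg (mul_nonneg (hχ01 x).1 (hb x).1)]
        by_cases hx : x ∈ U
        · rw [Set.indicator_of_mem hx]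
          exact mul_le_of_le_one_left zero_le (ENNReal.ofReal_le_one.2
            (mul_le_one₀ (hχ01 x).2 (hb x).1 (hb x).2))
        · simp [image_eq_zero_of_notMem_tsupport fun h => hx (hχU h)]
      · rw [enorm_indicator_eq_indicator_enorm]
    calc _ ≤ ∫⁻ x, (U.indicator (fun x => ‖G x‖ₑ) x + Nᶜ.indicator (fun x => ‖R x‖ₑ) x)
          ∂(volume + s) := lintegral_mono h1
      _ = m U + ∫⁻ x, ‖R x‖ₑ := by
        rw [lintegral_add_left (hGe.indicator hU.measurableSet),
          lintegral_indicator hU.measurableSet, lintegral_indicator hN.compl,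
          restrict_compl_add h0 hs, hm, withDensity_apply _ hU.measurableSet]
      _ ≤ (c + e) + (c + e + e) := by
        gcongr
        exact hUm.le.trans (by gcongr)
      _ = 2 * c + (e + e + e) := by ring
      _ ≤ _ := by gcongr

lemma exists_ae_limit_of_summable {X F : Type*} [MeasurableSpace X] [NormedAddCommGroup F]
    [CompleteSpace F]
    [MeasurableSpace F] [BorelSpace F] [SecondCountableTopology F] {μ : Measure X}
    {u : ℕ → X → F} (hm : ∀ k, Measurable (u k)) (h0 : Integrable (u 0) μ)
    (hs : ∑' k, ∫⁻ x, ‖u (k + 1) x - u k x‖ₑ ∂μ ≠ ⊤) :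
    ∃ U : X → F, Measurable U ∧ ∃ B : X → ℝ, Integrable B μ ∧
      (∀ᵐ x ∂μ, ∀ k, ‖u k x‖ ≤ B x) ∧ ∀ᵐ x ∂μ, Tendsto (fun k => u k x) atTop (𝓝 (U x)) := by
  have hdm : ∀ k, Measurable fun x => ‖u (k + 1) x - u k x‖ₑ := fun k =>
    ((hm (k + 1)).sub (hm k)).enorm
  set D : X → ℝ≥0∞ := fun x => ‖u 0 x‖ₑ + ∑' k, ‖u (k + 1) x - u k x‖ₑ with hD
  have hDm : Measurable D := (hm 0).enorm.add (Measurable.tsum hdm)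
  have hDi : ∫⁻ x, D x ∂μ ≠ ⊤ := by
    rw [hD, lintegral_add_left (hm 0).enorm, lintegral_tsum fun k => (hdm k).aemeasurable]
    exact ENNReal.add_ne_top.2 ⟨h0.2.ne, hs⟩
  have hfin : ∀ᵐ x ∂μ, D x < ⊤ := ae_lt_top hDm hDi
  have hlim : ∀ᵐ x ∂μ, ∃ l, Tendsto (fun k => u k x) atTop (𝓝 l) := by
    filter_upwards [hfin] with x hx
    refine cauchySeq_tendsto_of_complete (cauchySeq_of_edist_le_of_tsum_ne_top
      (fun k => ‖u (k + 1) x - u k x‖ₑ) (fun k => ?_) (ENNReal.add_lt_top.1 hx).2.ne)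
    rw [edist_comm, edist_eq_enorm_sub]
  obtain ⟨U, hU, hUl⟩ := measurable_limit_of_tendsto_metrizable_ae (fun k => (hm k).aemeasurable)
    hlim
  refine ⟨U, hU, fun x => (D x).toReal, integrable_toReal_of_lintegral_ne_top hDm.aemeasurable hDi,
    ?_, hUl⟩
  filter_upwards [hfin] with x hx k
  have h1 : ‖u k x‖ₑ ≤ ‖u 0 x‖ₑ + ∑ i ∈ Finset.range k, ‖u (i + 1) x - u i x‖ₑ := by
    induction k with
    | zero => simp
    | succ k ih =>
      rw [Finset.sum_range_succ, ← add_assoc]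
      calc ‖u (k + 1) x‖ₑ = ‖u k x + (u (k + 1) x - u k x)‖ₑ := by rw [add_sub_cancel]
        _ ≤ ‖u k x‖ₑ + ‖u (k + 1) x - u k x‖ₑ := enorm_add_le _ _
        _ ≤ _ := by gcongr
  have h2 : ‖u k x‖ₑ ≤ D x := h1.trans (add_le_add le_rfl (ENNReal.sum_le_tsum _))
  simpa using ENNReal.toReal_mono hx.ne h2

lemma IsState.limit {Ω : Set (Euc n)} {s : Measure (Euc n)}
    {f : ℕ → Euc n → ℝ} {G : ℕ → Euc n → Euc n} (S : ∀ k, IsState Ω s (f k) (G k))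
    {h : Euc n → ℝ} (hh : ∀ x, Tendsto (fun k => f k x) atTop (𝓝 (h x)))
    (hf : ∑' k, ∫⁻ x, ‖f (k + 1) x - f k x‖ₑ ≠ ⊤)
    (hG : ∑' k, ∫⁻ x, ‖G (k + 1) x - G k x‖ₑ ∂(volume + s) ≠ ⊤) :
    ∃ H, IsState Ω s h H ∧
      ∀ᵐ x ∂(volume + s), Tendsto (fun k => G k x) atTop (𝓝 (H x)) := by
  obtain ⟨-, -, B, hB, hfB, -⟩ := exists_ae_limit_of_summable (fun k => (S k).meas) (S 0).int hf
  obtain ⟨H, hH, B', hB', hGB, hGl⟩ := exists_ae_limit_of_summable (fun k => (S k).gmeas)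
    (S 0).gint hG
  have hhm : Measurable h := measurable_of_tendsto_metrizable (fun k => (S k).meas)
    (tendsto_pi_nhds.2 hh)
  refine ⟨H, ⟨hhm, ?_, hH, ?_, ?_⟩, hGl⟩
  · refine hB.mono' hhm.aestronglyMeasurable ?_
    filter_upwards [hfB] with x hx
    exact le_of_tendsto' (hh x).norm hx
  · refine hB'.mono' hH.aestronglyMeasurable ?_
    filter_upwards [hGB, hGl] with x hx hx'
    exact le_of_tendsto' hx'.norm hx
  · intro φ hφ hφc hφΩ v
    have hφ' : Continuous fun x => fderiv ℝ φ x v :=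
      (hφ.continuous_fderiv one_ne_zero).clm_apply continuous_const
    have hφsupp : HasCompactSupport fun x => fderiv ℝ φ x v := hφc.fderiv_apply (𝕜 := ℝ) v
    obtain ⟨C, hC⟩ := hφ.continuous.bounded_above_of_compact_support hφc
    obtain ⟨C', hC'⟩ := hφ'.bounded_above_of_compact_support hφsupp
    have L1 : Tendsto (fun k => ∫ x, f k x * fderiv ℝ φ x v) atTop
        (𝓝 (∫ x, h x * fderiv ℝ φ x v)) := by
      refine tendsto_integral_of_dominated_convergence (fun x => B x * C')
        (fun k => ((S k).meas.mul hφ'.measurable).aestronglyMeasurable) (hB.mul_const C')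
        (fun k => ?_) (ae_of_all _ fun x => (hh x).mul_const _)
      filter_upwards [hfB] with x hx
      rw [norm_mul]
      exact mul_le_mul (hx k) (hC' x) (norm_nonneg _) ((norm_nonneg _).trans (hx k))
    have L2 : Tendsto (fun k => ∫ x, φ x * ⟪v, G k x⟫ ∂(volume + s)) atTop
        (𝓝 (∫ x, φ x * ⟪v, H x⟫ ∂(volume + s))) := by
      refine tendsto_integral_of_dominated_convergence (fun x => C * (‖v‖ * B' x))
        (fun k => (hφ.continuous.measurable.mul
          (measurable_const.inner (S k).gmeas)).aestronglyMeasurable)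
        ((hB'.const_mul _).const_mul _) (fun k => ?_) ?_
      · filter_upwards [hGB] with x hx
        rw [norm_mul]
        exact mul_le_mul (hC x) ((norm_inner_le_norm _ _).trans (by gcongr; exact hx k))
          (norm_nonneg _) ((norm_nonneg _).trans (hC x))
      · filter_upwards [hGl] with x hx
        exact (tendsto_const_nhds.inner hx).const_mul _
    refine tendsto_nhds_unique L1 ?_
    simp only [fun k => (S k).grad φ hφ hφc hφΩ v]
    exact L2.neg

lemma IsState.exists_sbv {Ω : Set (Euc n)} (hΩ : IsOpen Ω) {s : Measure (Euc n)}
    [IsFiniteMeasure s] {N : Set (Euc n)} (hN : MeasurableSet N) (h0 : volume N = 0)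
    (hs : s Nᶜ = 0) {f₀ : Euc n → ℝ} {G₀ : Euc n → Euc n} (S₀ : IsState Ω s f₀ G₀) {δ : ℝ}
    (hδ : 0 < δ) :
    ∃ (h : Euc n → ℝ) (H : Euc n → Euc n), IsState Ω s h H ∧ (∀ x, |h x - f₀ x| ≤ δ / 2) ∧
      ∫⁻ x, ‖H x‖ₑ ≤ (∫⁻ x, ‖G₀ x‖ₑ) +
        (∫⁻ x in Ω \ approxDiscontSet n f₀, ‖G₀ x‖ₑ ∂s) + ENNReal.ofReal (3 * δ) ∧
      ∫⁻ x in jumpSet n h ∩ Ω, ‖H x‖ₑ ∂s ≤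
        (∫⁻ x in jumpSet n f₀ ∩ Ω, ‖G₀ x‖ₑ ∂s) + ENNReal.ofReal (2 * δ) ∧
      ∫⁻ x in Ω \ approxDiscontSet n h, ‖H x‖ₑ ∂s = 0 := by
  let X := {p : (Euc n → ℝ) × (Euc n → Euc n) // IsState Ω s p.1 p.2}
  let η : ℕ → ℝ≥0∞ := fun k => ENNReal.ofReal (δ / 2 / 2 ^ k)
  have hη0 : ∀ k, η k ≠ 0 := fun k => (ENNReal.ofReal_pos.2 (by positivity)).ne'
  have hηs : ∑' k, η k = ENNReal.ofReal δ := by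
    rw [← ENNReal.ofReal_tsum_of_nonneg (fun k => by positivity) (summable_geometric_two' δ),
      tsum_geometric_two']
  have hη_top : ∑' k, η k ≠ ⊤ := hηs ▸ ENNReal.ofReal_ne_top
  choose f₁ G₁ C₁ hS₁ hC₁ hd₁ he₁ hi₁ hm₁ hc₁ hr₁ hv₁ hl₁ using fun (k : ℕ) (p : X) =>
    p.2.step hΩ hN h0 hs (δ := δ / 2 / 2 / 2 ^ k) (by positivity) (hη0 k)
  let p : ℕ → X := fun k => Nat.rec ⟨(f₀, G₀), S₀⟩ (fun k q => ⟨(f₁ k q, G₁ k q), hS₁ k q⟩) k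
  let f : ℕ → Euc n → ℝ := fun k => (p k).1.1
  let G : ℕ → Euc n → Euc n := fun k => (p k).1.2
  let C : ℕ → Set (Euc n) := fun k => C₁ k (p k)
  let D : ℕ → Set (Euc n) := fun k => Ω \ approxDiscontSet n (f k)
  let c : ℕ → ℝ≥0∞ := fun k => ∫⁻ x in D k, ‖G k x‖ₑ ∂s
  have hS : ∀ k, IsState Ω s (f k) (G k) := fun k => (p k).2
  have hC : ∀ k, IsClosed (C k) := fun k => hC₁ k (p k)
  have hd : ∀ k x, |f (k + 1) x - f k x| ≤ δ / 2 / 2 / 2 ^ k := fun k => hd₁ k (p k)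
  have he : ∀ k, ∀ x ∉ C k, f (k + 1) x = f k x := fun k => he₁ k (p k)
  have hi : ∀ k, ∫⁻ x, ‖f (k + 1) x - f k x‖ₑ ≤ η k := fun k => hi₁ k (p k)
  have hm : ∀ k, ∀ᵐ x ∂s, ‖G (k + 1) x‖ₑ ≤ ‖G k x‖ₑ := fun k => hm₁ k (p k)
  have hc : ∀ k, ∫⁻ x in C k, ‖G (k + 1) x‖ₑ ∂s ≤ η k := fun k => hc₁ k (p k)
  have hr : ∀ k, ∫⁻ x in D k \ C k, ‖G k x‖ₑ ∂s ≤ η k := fun k => hr₁ k (p k)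
  have hv : ∀ k, ∫⁻ x, ‖G (k + 1) x‖ₑ ≤ (∫⁻ x, ‖G k x‖ₑ) + c k + η k := fun k => hv₁ k (p k)
  have hl : ∀ k, ∫⁻ x, ‖G (k + 1) x - G k x‖ₑ ∂(volume + s) ≤ 2 * c k + η k :=
    fun k => hl₁ k (p k)
  have hloc : ∀ k, LocallyIntegrable (f k) := fun k => (hS k).int.locallyIntegrable
  -- decay of the mass of Cantor type
  have hDsub : ∀ k, D (k + 1) ⊆ C k ∪ (D k \ C k) := fun k x hx => by
    by_cases hxC : x ∈ C k
    · exact Or.inl hxC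
    · refine Or.inr ⟨⟨hx.1, fun h => hx.2 ?_⟩, hxC⟩
      have : NearAt (f (k + 1)) (f k) x := nearAt_of_eventuallyEq
        (Filter.mem_of_superset ((hC k).isOpen_compl.mem_nhds hxC) fun y hy => he k y hy)
      exact (this.approxDiscontSet_iff (hloc k) (hloc (k + 1))).2 h
  have hcs : ∀ k, c (k + 1) ≤ 2 * η k := fun k => by
    calc c (k + 1) ≤ ∫⁻ x in C k ∪ (D k \ C k), ‖G (k + 1) x‖ₑ ∂s := lintegral_mono_set (hDsub k)
      _ ≤ (∫⁻ x in C k, ‖G (k + 1) x‖ₑ ∂s) + ∫⁻ x in D k \ C k, ‖G (k + 1) x‖ₑ ∂s :=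
        lintegral_union_le _ _ _
      _ ≤ η k + ∫⁻ x in D k \ C k, ‖G k x‖ₑ ∂s := by
        gcongr ?_ + ?_
        · exact hc k
        · exact lintegral_mono_ae (ae_restrict_of_ae (hm k))
      _ ≤ 2 * η k := by rw [two_mul]; gcongr; exact hr k
  have hc0 : c 0 ≠ ⊤ := by
    have h1 : ∫⁻ x, ‖G 0 x‖ₑ ∂s ≤ ∫⁻ x, ‖G 0 x‖ₑ ∂(volume + s) :=
      lintegral_mono' (Measure.le_add_left le_rfl) le_rfl
    exact ((setLIntegral_le_lintegral _ _).trans h1).trans_lt (hS 0).gint.2 |>.ne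
  -- convergence
  have hGs : ∑' k, ∫⁻ x, ‖G (k + 1) x - G k x‖ₑ ∂(volume + s) ≠ ⊤ := by
    have h1 : ∑' k, c k ≤ c 0 + 2 * ∑' k, η k := by
      rw [tsum_eq_zero_add' ENNReal.summable, ← ENNReal.tsum_mul_left]
      gcongr with k
      exact hcs k
    refine ne_top_of_le_ne_top ?_ (ENNReal.tsum_le_tsum hl)
    rw [ENNReal.tsum_add, ENNReal.tsum_mul_left]
    refine ENNReal.add_ne_top.2 ⟨ENNReal.mul_ne_top (by simp) (ne_top_of_le_ne_top ?_ h1), hη_top⟩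
    exact ENNReal.add_ne_top.2 ⟨hc0, ENNReal.mul_ne_top (by simp) hη_top⟩
  have hdist : ∀ x k, dist (f k x) (f (k + 1) x) ≤ δ / 2 / 2 / 2 ^ k := fun x k => by
    rw [dist_comm, Real.dist_eq]; exact hd k x
  choose h hh using fun x => cauchySeq_tendsto_of_complete (cauchySeq_of_le_geometric_two (hdist x))
  have hhd : ∀ k x, |h x - f k x| ≤ δ / 2 / 2 ^ k := fun k x => by
    have := dist_le_of_le_geometric_two_of_tendsto (hdist x) (hh x) k
    rwa [dist_comm, Real.dist_eq] at this
  obtain ⟨H, hSH, hGl⟩ := IsState.limit hS hh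
    (ne_top_of_le_ne_top hη_top (ENNReal.tsum_le_tsum hi)) hGs
  obtain ⟨hGlv, hGls⟩ := ae_add_measure_iff.1 hGl
  have hHle : ∀ᵐ x ∂s, ∀ k, ‖H x‖ₑ ≤ ‖G k x‖ₑ := by
    filter_upwards [hGls, ae_all_iff.2 hm] with x hx hx' k
    exact (antitone_nat_of_succ_le hx').le_of_tendsto hx.enorm k
  have hHset : ∀ (A : Set (Euc n)) (k : ℕ), ∫⁻ x in A, ‖H x‖ₑ ∂s ≤ ∫⁻ x in A, ‖G k x‖ₑ ∂s :=
    fun A k => lintegral_mono_ae (ae_restrict_of_ae (hHle.mono fun x hx => hx k))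
  have hHC : ∀ k, ∫⁻ x in C k, ‖H x‖ₑ ∂s ≤ η k := fun k => (hHset _ (k + 1)).trans (hc k)
  -- the limit is close to each term off the later modifications
  have hnear : ∀ k x, (∀ j, x ∉ C (j + k)) → NearAt h (f k) x := fun k x hx ε hε => by
    have hm : ∀ m, ∀ᶠ y in 𝓝 x, f (m + k) y = f k y := fun m => by
      induction m with
      | zero => simp
      | succ m ih =>
        filter_upwards [ih, (hC (m + k)).isOpen_compl.mem_nhds (hx m)] with y hy hyC
        rw [← hy, show m + 1 + k = m + k + 1 by ring]
        exact he _ y hyC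
    obtain ⟨m, hmε⟩ : ∃ m : ℕ, δ / 2 / 2 ^ m ≤ ε := by
      have : Tendsto (fun m : ℕ => δ / 2 / 2 ^ m) atTop (𝓝 0) :=
        (summable_geometric_two' δ).tendsto_atTop_zero
      exact (this.eventually_le_const hε).exists
    obtain ⟨r₀, hr₀, hball⟩ := Metric.eventually_nhds_iff_ball.1 (hm m)
    filter_upwards [Ioo_mem_nhdsGT hr₀] with r hr
    filter_upwards [ae_restrict_mem measurableSet_ball] with y hy
    rw [← hball y (ball_subset_ball hr.2.le hy)]
    refine (hhd (m + k) y).trans (le_trans ?_ hmε)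
    gcongr
    · norm_num
    · omega
  have hhl : LocallyIntegrable h := hSH.int.locallyIntegrable
  refine ⟨h, H, hSH, fun x => (hhd 0 x).trans (by simp), ?_, ?_, ?_⟩
  · have hsum : ∀ k, ∫⁻ x, ‖G (k + 1) x‖ₑ ≤ (∫⁻ x, ‖G 0 x‖ₑ) + c 0 +
        2 * (∑ i ∈ Finset.range k, η i) + ∑ i ∈ Finset.range (k + 1), η i := fun k => by
      induction k with
      | zero => simpa using hv 0
      | succ k ih =>
        refine (hv (k + 1)).trans ?_
        rw [Finset.sum_range_succ η (k + 1)]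
        calc _ ≤ ((∫⁻ x, ‖G 0 x‖ₑ) + c 0 + 2 * (∑ i ∈ Finset.range k, η i) +
              ∑ i ∈ Finset.range (k + 1), η i) + 2 * η k + η (k + 1) := by
              gcongr
              exact hcs k
          _ = _ := by rw [Finset.sum_range_succ η k]; ring
    have hb : ∀ k, ∫⁻ x, ‖G (k + 1) x‖ₑ ≤ (∫⁻ x, ‖G 0 x‖ₑ) + c 0 + ENNReal.ofReal (3 * δ) :=
      fun k => by
      refine (hsum k).trans ?_
      rw [ENNReal.ofReal_mul (by norm_num), ← hηs, add_assoc _ (2 * _)]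
      gcongr
      calc _ ≤ 2 * (∑' k, η k) + ∑' k, η k := by gcongr <;> exact ENNReal.sum_le_tsum _
        _ = _ := by
          rw [show ENNReal.ofReal 3 = 3 by norm_num]; ring
    calc ∫⁻ x, ‖H x‖ₑ = ∫⁻ x, liminf (fun k => ‖G (k + 1) x‖ₑ) atTop := by
          refine lintegral_congr_ae ?_
          filter_upwards [hGlv] with x hx
          exact (((tendsto_add_atTop_iff_nat 1).2 hx).enorm.liminf_eq).symm
      _ ≤ liminf (fun k => ∫⁻ x, ‖G (k + 1) x‖ₑ) atTop :=
          lintegral_liminf_le fun k => (hS (k + 1)).gmeas.enorm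
      _ ≤ liminf (fun _ : ℕ => (∫⁻ x, ‖G 0 x‖ₑ) + c 0 + ENNReal.ofReal (3 * δ)) atTop :=
          liminf_le_liminf (Eventually.of_forall hb)
      _ = _ := liminf_const _
  · have hsub : jumpSet n h ∩ Ω ⊆ (jumpSet n f₀ ∩ Ω) ∪ ⋃ k, C k := fun x hx => by
      by_cases hxC : x ∈ ⋃ k, C k
      · exact Or.inr hxC
      · refine Or.inl ⟨?_, hx.2⟩
        exact (hnear 0 x fun j hj => hxC (Set.mem_iUnion.2 ⟨j, hj⟩)).symm.mem_jumpSet hhl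
          (hloc 0) hx.1
    calc ∫⁻ x in jumpSet n h ∩ Ω, ‖H x‖ₑ ∂s
        ≤ ∫⁻ x in (jumpSet n f₀ ∩ Ω) ∪ ⋃ k, C k, ‖H x‖ₑ ∂s := lintegral_mono_set hsub
      _ ≤ (∫⁻ x in jumpSet n f₀ ∩ Ω, ‖H x‖ₑ ∂s) + ∫⁻ x in ⋃ k, C k, ‖H x‖ₑ ∂s :=
        lintegral_union_le _ _ _
      _ ≤ (∫⁻ x in jumpSet n f₀ ∩ Ω, ‖G₀ x‖ₑ ∂s) + ∑' k, η k := by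
        gcongr ?_ + ?_
        · exact hHset _ 0
        · exact (lintegral_iUnion_le _ _).trans (ENNReal.tsum_le_tsum hHC)
      _ ≤ _ := by
        rw [hηs]
        gcongr
        linarith
  · have hsub : ∀ k, Ω \ approxDiscontSet n h ⊆ (D k \ C k) ∪ ⋃ j, C (j + k) := fun k x hx => by
      by_cases hxC : x ∈ ⋃ j, C (j + k)
      · exact Or.inr hxC
      · have hx' : ∀ j, x ∉ C (j + k) := fun j hj => hxC (Set.mem_iUnion.2 ⟨j, hj⟩)
        refine Or.inl ⟨⟨hx.1, fun h' => hx.2 ?_⟩, by simpa using hx' 0⟩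
        exact ((hnear k x hx').approxDiscontSet_iff (hloc k) hhl).2 h'
    have hb : ∀ k, ∫⁻ x in Ω \ approxDiscontSet n h, ‖H x‖ₑ ∂s ≤ 2 * ∑' j, η (j + k) := fun k => by
      calc _ ≤ ∫⁻ x in (D k \ C k) ∪ ⋃ j, C (j + k), ‖H x‖ₑ ∂s := lintegral_mono_set (hsub k)
        _ ≤ (∫⁻ x in D k \ C k, ‖H x‖ₑ ∂s) + ∫⁻ x in ⋃ j, C (j + k), ‖H x‖ₑ ∂s :=
          lintegral_union_le _ _ _
        _ ≤ η k + ∑' j, η (j + k) := by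
          gcongr ?_ + ?_
          · exact (hHset _ k).trans (hr k)
          · exact (lintegral_iUnion_le _ _).trans (ENNReal.tsum_le_tsum fun j => hHC _)
        _ ≤ 2 * ∑' j, η (j + k) := by
          rw [two_mul]
          gcongr
          simpa using ENNReal.le_tsum (f := fun j => η (j + k)) 0
    have hlim : Tendsto (fun k => 2 * ∑' j, η (j + k)) atTop (𝓝 0) := by
      simpa using ENNReal.Tendsto.const_mul (ENNReal.tendsto_sum_nat_add η hη_top)
        (a := 2) (Or.inr (by simp))
    exact le_antisymm (ge_of_tendsto' hlim hb) zero_le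

lemma exists_tendsto_ultrafilter_of_bounded (ω : Ultrafilter ℕ) {a : ℕ → ℝ} {C : ℝ}
    (h : ∀ j, |a j| ≤ C) : ∃ l, Tendsto a ω (𝓝 l) := by
  obtain ⟨l, -, hl⟩ := (isCompact_Icc (a := -C) (b := C)).ultrafilter_le_nhds (ω.map a) (by
    rw [le_principal_iff]
    exact Filter.mem_map.2 (Filter.univ_mem' fun j => abs_le.1 (h j)))
  exact ⟨l, hl⟩

/-- Weak-star compactness of bounded sequences of nonnegative densities. -/
lemma exists_measure_tendsto (ω : Ultrafilter ℕ) {q : ℕ → Euc n → ℝ} {V : ℝ}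
    (hq : ∀ j, Integrable (q j)) (hq0 : ∀ j x, 0 ≤ q j x) (hV : ∀ j, ∫ x, q j x ≤ V) :
    ∃ ν : Measure (Euc n), IsFiniteMeasure ν ∧ ∀ φ : Euc n → ℝ, Continuous φ →
      HasCompactSupport φ → Tendsto (fun j => ∫ x, φ x * q j x) ω (𝓝 (∫ x, φ x ∂ν)) := by
  have hV0 : 0 ≤ V := (integral_nonneg (hq0 0)).trans (hV 0)
  have hInt : ∀ φ : CompactlySupportedContinuousMap (Euc n) ℝ, ∀ j,
      Integrable fun x => φ x * q j x := by
    intro φ j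
    obtain ⟨C, hC⟩ := φ.continuous.bounded_above_of_compact_support φ.hasCompactSupport
    exact (hq j).bdd_mul (c := C) φ.continuous.aestronglyMeasurable (ae_of_all _ hC)
  have hbound : ∀ φ : CompactlySupportedContinuousMap (Euc n) ℝ, ∀ C, (∀ x, ‖φ x‖ ≤ C) →
      ∀ j, |∫ x, φ x * q j x| ≤ C * V := by
    intro φ C hC j
    have hC0 : 0 ≤ C := (norm_nonneg _).trans (hC 0)
    rw [← Real.norm_eq_abs]
    refine (norm_integral_le_of_norm_le ((hq j).const_mul C) (ae_of_all _ fun x => ?_)).trans ?_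
    · rw [norm_mul, Real.norm_of_nonneg (hq0 j x)]
      exact mul_le_mul_of_nonneg_right (hC x) (hq0 j x)
    · rw [integral_const_mul]; exact mul_le_mul_of_nonneg_left (hV j) hC0
  have hex : ∀ φ : CompactlySupportedContinuousMap (Euc n) ℝ, ∃ l,
      Tendsto (fun j => ∫ x, φ x * q j x) ω (𝓝 l) := by
    intro φ
    obtain ⟨C, hC⟩ := φ.continuous.bounded_above_of_compact_support φ.hasCompactSupport
    exact exists_tendsto_ultrafilter_of_bounded ω (hbound φ C hC)
  choose L hL using hex
  let Λ₀ : CompactlySupportedContinuousMap (Euc n) ℝ →ₗ[ℝ] ℝ :=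
    { toFun := L
      map_add' := fun φ ψ => by
        refine tendsto_nhds_unique (hL (φ + ψ)) (((hL φ).add (hL ψ)).congr fun j => ?_)
        rw [← integral_add (hInt φ j) (hInt ψ j)]
        refine integral_congr_ae (ae_of_all _ fun x => ?_)
        simp [add_mul]
      map_smul' := fun c φ => by
        refine tendsto_nhds_unique (hL (c • φ)) (((hL φ).const_mul c).congr fun j => ?_)
        rw [← integral_const_mul]
        refine integral_congr_ae (ae_of_all _ fun x => ?_)
        simp [mul_assoc] }
  let Λ : CompactlySupportedContinuousMap (Euc n) ℝ →ₚ[ℝ] ℝ := PositiveLinearMap.mk₀ Λ₀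
    fun φ hφ => ge_of_tendsto' (hL φ) fun j =>
      integral_nonneg fun x => mul_nonneg (hφ x) (hq0 j x)
  have hΛ : ∀ φ, Λ φ = L φ := fun φ => rfl
  refine ⟨RealRMK.rieszMeasure Λ, ⟨?_⟩, fun φ hφ hc => ?_⟩
  · have hball : ∀ k : ℕ, RealRMK.rieszMeasure Λ (closedBall (0 : Euc n) k) ≤ ENNReal.ofReal V := by
      intro k
      obtain ⟨χ, h1, h2, -, h4, h5⟩ := exists_cutoff (isCompact_closedBall (0 : Euc n) k)
        isOpen_univ (Set.subset_univ _)
      let X : CompactlySupportedContinuousMap (Euc n) ℝ := ⟨⟨χ, h1.continuous⟩, h2⟩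
      refine (RealRMK.rieszMeasure_le_of_eq_one Λ (f := X) (fun x => (h4 x).1)
        (isCompact_closedBall _ _) h5).trans (ENNReal.ofReal_le_ofReal ?_)
      rw [hΛ]
      refine le_of_tendsto' (hL X) fun j => (le_abs_self _).trans ?_
      have := hbound X 1 (fun x => by
        change ‖χ x‖ ≤ 1; rw [Real.norm_of_nonneg (h4 x).1]; exact (h4 x).2) j
      rwa [one_mul] at this
    have hm : Monotone fun k : ℕ => closedBall (0 : Euc n) k := fun a b hab =>
      closedBall_subset_closedBall (by exact_mod_cast hab)
    rw [← iUnion_closedBall_nat (0 : Euc n), hm.measure_iUnion]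
    exact (iSup_le hball).trans_lt ENNReal.ofReal_lt_top
  · have h1 := RealRMK.integral_rieszMeasure Λ (⟨⟨φ, hφ⟩, hc⟩ : CompactlySupportedContinuousMap (Euc n) ℝ)
    have h2 := hL ⟨⟨φ, hφ⟩, hc⟩
    rw [← hΛ, ← h1] at h2
    exact h2

lemma tsupport_mollify_subset {ζ : Euc n → ℝ} (j : ℕ) :
    tsupport (mollify j ζ) ⊆ cthickening (mollRadius j) (tsupport ζ) := by
  refine closure_minimal (fun x hx => ?_) isClosed_cthickening
  by_contra hcon
  refine hx (integral_eq_zero_of_ae (ae_of_all _ fun y => ?_))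
  by_cases hy : ζ y = 0
  · simp [hy]
  · simp only [Pi.zero_apply]
    rw [moll_sub_eq_zero, mul_zero]
    by_contra hlt
    exact hcon (mem_cthickening_of_dist_le x y _ _ (subset_tsupport _ hy) (not_le.1 hlt).le)

lemma hasCompactSupport_mollify {ζ : Euc n → ℝ} (hζ : HasCompactSupport ζ) (j : ℕ) :
    HasCompactSupport (mollify j ζ) :=
  (hζ.isCompact.cthickening (r := mollRadius j)).of_isClosed_subset (isClosed_tsupport _)
    (tsupport_mollify_subset j)

lemma tsupport_mollify_subset_of_closedBall {ζ : Euc n → ℝ} {Ω : Set (Euc n)}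
    (hζ : HasCompactSupport ζ) {j : ℕ} (h : ∀ x ∈ tsupport ζ, closedBall x (mollRadius j) ⊆ Ω) :
    tsupport (mollify j ζ) ⊆ Ω := by
  refine (tsupport_mollify_subset j).trans ?_
  rw [hζ.isCompact.cthickening_eq_biUnion_closedBall (mollRadius_pos j).le]
  exact Set.iUnion₂_subset h

lemma integral_mul_fderiv_le_variation {f f₀ : Euc n → ℝ} {Ω : Set (Euc n)} (hΩ : IsOpen Ω)
    (hv : variation n f Ω < ⊤) (hf₀ : f₀ =ᵐ[volume] Ω.indicator f) {φ : Euc n → ℝ}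
    (hφ : ContDiff ℝ 1 φ) (hφc : HasCompactSupport φ) (hφΩ : tsupport φ ⊆ Ω)
    (h1 : ∀ x, |φ x| ≤ 1) (i : Fin n) :
    ∫ x, f₀ x * fderiv ℝ φ x (EuclideanSpace.single i 1) ≤ (variation n f Ω).toReal := by
  let Φ : Euc n → Euc n := fun x => φ x • EuclideanSpace.single i (1 : ℝ)
  have hdiv : ∀ x, vdiv n Φ x = fderiv ℝ φ x (EuclideanSpace.single i 1) := by
    intro x
    have h := ((hφ.differentiable one_ne_zero x).hasFDerivAt).smul_const
      (EuclideanSpace.single i (1 : ℝ))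
    rw [vdiv, h.fderiv]
    simp
  have hsupp : tsupport Φ ⊆ tsupport φ := closure_mono fun x hx => by
    intro h0; exact hx (by simp [Φ, h0])
  have key : ENNReal.ofReal (∫ x in Ω, f x * vdiv n Φ x) ≤ variation n f Ω := by
    unfold variation
    refine le_iSup_of_le Φ (le_iSup_of_le (hφ.smul contDiff_const) (le_iSup_of_le ?_
      (le_iSup_of_le (hsupp.trans hφΩ) (le_iSup_of_le (fun x => ?_) le_rfl))))
    · exact hφc.of_isClosed_subset (isClosed_tsupport _) hsupp
    · simp only [Φ, norm_smul, Real.norm_eq_abs]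
      simpa using h1 x
  rw [ENNReal.ofReal_le_iff_le_toReal hv.ne] at key
  refine le_of_eq_of_le ?_ key
  rw [← integral_indicator hΩ.measurableSet]
  refine integral_congr_ae ?_
  filter_upwards [hf₀] with x hx
  by_cases hxΩ : x ∈ Ω
  · simp [hx, hxΩ, hdiv]
  · simp [hx, hxΩ]

lemma integral_mul_abs_fderiv_mollify_le {f : Euc n → ℝ} {Ω : Set (Euc n)} {V : ℝ} {v : Euc n}
    (hf : Integrable f)
    (hV : ∀ φ : Euc n → ℝ, ContDiff ℝ 1 φ → HasCompactSupport φ → tsupport φ ⊆ Ω →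
      (∀ x, |φ x| ≤ 1) → ∫ x, f x * fderiv ℝ φ x v ≤ V)
    {ψ : Euc n → ℝ} (hψ : ContDiff ℝ 1 ψ) (hψc : HasCompactSupport ψ)
    (h01 : ∀ x, ψ x ∈ Set.Icc (0 : ℝ) 1) {j : ℕ}
    (hj : ∀ x ∈ tsupport ψ, closedBall x (mollRadius j) ⊆ Ω) :
    ∫ x, ψ x * |fderiv ℝ (mollify j f) x v| ≤ V := by
  set p : Euc n → ℝ := fun x => fderiv ℝ (mollify j f) x v with hp
  have hm : ContDiff ℝ 2 (mollify j f) := contDiff_mollify hf.locallyIntegrable j 2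
  have hpd : ContDiff ℝ 1 p := (hm.fderiv_right (by norm_num)).clm_apply contDiff_const
  have hci : ∀ u : Euc n → ℝ, Continuous u → Integrable fun x => ψ x * u x := fun u hu =>
    (hψ.continuous.mul hu).integrable_of_hasCompactSupport hψc.mul_right
  have hmain : ∀ θ : ℝ, 0 < θ → ∫ x, ψ x * |p x| ≤ V + θ * ∫ x, ψ x := by
    intro θ hθ
    have hpos : ∀ x, 0 < θ ^ 2 + p x ^ 2 := fun x => by positivity
    have hsq : ContDiff ℝ 1 fun x => √(θ ^ 2 + p x ^ 2) :=
      (contDiff_const.add (hpd.pow 2)).sqrt fun x => (hpos x).ne'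
    have hsq0 : ∀ x, 0 < √(θ ^ 2 + p x ^ 2) := fun x => Real.sqrt_pos.2 (hpos x)
    have hle : ∀ x, |p x| ≤ √(θ ^ 2 + p x ^ 2) := fun x => by
      rw [← Real.sqrt_sq_eq_abs]; exact Real.sqrt_le_sqrt (by nlinarith [sq_nonneg θ])
    let g : Euc n → ℝ := fun x => -(p x / √(θ ^ 2 + p x ^ 2))
    have hg : ContDiff ℝ 1 g := (hpd.div hsq fun x => (hsq0 x).ne').neg
    let ζ : Euc n → ℝ := fun x => ψ x * g x
    have hζ : ContDiff ℝ 1 ζ := hψ.mul hg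
    have hζc : HasCompactSupport ζ := hψc.mul_right
    have hζs : tsupport ζ ⊆ tsupport ψ := tsupport_mul_subset_left
    have hg1 : ∀ x, |g x| ≤ 1 := fun x => by
      simp only [g, abs_neg, abs_div, abs_of_pos (hsq0 x)]
      exact (div_le_one (hsq0 x)).2 (hle x)
    have hζ1 : ∀ x, ζ x ∈ Set.Icc (-1 : ℝ) 1 := fun x => abs_le.1 (by
      simp only [ζ, abs_mul, abs_of_nonneg (h01 x).1]
      exact mul_le_one₀ (h01 x).2 (abs_nonneg _) (hg1 x))
    have hζi : Integrable ζ := hci g hg.continuous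
    have hdc : Continuous fun x => fderiv ℝ ζ x v :=
      (hζ.continuous_fderiv one_ne_zero).clm_apply continuous_const
    have hds : HasCompactSupport fun x => fderiv ℝ ζ x v := hζc.fderiv_apply (𝕜 := ℝ) v
    have hdi : Integrable fun x => fderiv ℝ ζ x v := hdc.integrable_of_hasCompactSupport hds
    have h1 := hV (mollify j ζ) (contDiff_mollify hζi.locallyIntegrable j 1)
      (hasCompactSupport_mollify hζc j)
      (tsupport_mollify_subset_of_closedBall hζc fun x hx => hj x (hζs hx))
      fun x => abs_le.2 (mollify_mem_Icc hζ.continuous hζ1 j x)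
    simp only [fderiv_mollify_of_contDiff hζ hζc] at h1
    rw [← integral_mollify_mul hf hdi, integral_mul_fderiv_eq_neg_fderiv_mul_of_integrable
      ((hpd.continuous.mul hζ.continuous).integrable_of_hasCompactSupport hζc.mul_left)
      ((hm.continuous.mul hdc).integrable_of_hasCompactSupport hds.mul_left)
      ((hm.continuous.mul hζ.continuous).integrable_of_hasCompactSupport hζc.mul_left)
      (fun x _ => hm.differentiable two_ne_zero x)
      (fun x _ => hζ.differentiable one_ne_zero x), ← integral_neg] at h1
    have h2 : ∫ x, ψ x * (|p x| - θ) ≤ V := by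
      refine le_trans (integral_mono (hci _ (hpd.continuous.abs.sub continuous_const)) ?_
        fun x => ?_) h1
      · exact ((hpd.continuous.mul hζ.continuous).integrable_of_hasCompactSupport
          hζc.mul_left).neg
      · have e : -(p x * ζ x) = ψ x * (p x ^ 2 / √(θ ^ 2 + p x ^ 2)) := by
          simp only [ζ, g]; ring
        change ψ x * (|p x| - θ) ≤ -(p x * ζ x)
        rw [e]
        refine mul_le_mul_of_nonneg_left ?_ (h01 x).1
        rw [le_div_iff₀ (hsq0 x)]
        have h3 : √(θ ^ 2 + p x ^ 2) ≤ |p x| + θ := by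
          rw [Real.sqrt_le_left (by positivity)]
          nlinarith [sq_abs (p x), abs_nonneg (p x)]
        rcases le_or_gt (|p x|) θ with h4 | h4
        · nlinarith [hsq0 x, sq_nonneg (p x)]
        · nlinarith [sq_abs (p x), sq_nonneg θ]
    have h4 : Integrable fun x => ψ x * |p x| := hci _ hpd.continuous.abs
    have h5 : Integrable fun x => ψ x * θ := hci _ continuous_const
    simp only [mul_sub] at h2
    rw [integral_sub h4 h5, integral_mul_const] at h2
    linarith
  have hlim : Tendsto (fun θ : ℝ => V + θ * ∫ x, ψ x) (𝓝[>] 0) (𝓝 (V + 0 * ∫ x, ψ x)) := by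
    refine tendsto_nhdsWithin_of_tendsto_nhds ?_ |>.mono_left le_rfl
    exact (continuous_const.add (continuous_id.mul continuous_const)).tendsto 0
  rw [zero_mul, add_zero] at hlim
  exact ge_of_tendsto hlim (eventually_mem_nhdsWithin.mono hmain)

lemma exists_cutoff_exhaustion {Ω : Set (Euc n)} :
    ∃ ψ : ℕ → Euc n → ℝ, (∀ j, ContDiff ℝ 1 (ψ j)) ∧ (∀ j, HasCompactSupport (ψ j)) ∧
      (∀ j x, ψ j x ∈ Set.Icc (0 : ℝ) 1) ∧
      (∀ j, ∀ x ∈ tsupport (ψ j), closedBall x (mollRadius j) ⊆ Ω) ∧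
      ∀ K : Set (Euc n), IsCompact K → (∃ d > 0, cthickening d K ⊆ Ω) →
        ∀ᶠ j in atTop, ∀ x ∈ K, ψ j x = 1 := by
  let K : ℕ → Set (Euc n) := fun j =>
    closedBall 0 j ∩ {x | ENNReal.ofReal (2 * mollRadius j) ≤ infEDist x Ωᶜ}
  let U : ℕ → Set (Euc n) := fun j => {x | ENNReal.ofReal (mollRadius j) < infEDist x Ωᶜ}
  have hK : ∀ j, IsCompact (K j) := fun j =>
    (isCompact_closedBall _ _).inter_right (isClosed_le continuous_const continuous_infEDist)
  have hU : ∀ j, IsOpen (U j) := fun j => isOpen_lt continuous_const continuous_infEDist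
  have hKU : ∀ j, K j ⊆ U j := fun j x hx => by
    have hx2 : ENNReal.ofReal (2 * mollRadius j) ≤ infEDist x Ωᶜ := hx.2
    refine lt_of_lt_of_le ?_ hx2
    have := mollRadius_pos j
    exact (ENNReal.ofReal_lt_ofReal_iff (by linarith)).2 (by linarith)
  choose ψ h1 h2 h3 h4 h5 using fun j => exists_cutoff (hK j) (hU j) (hKU j)
  refine ⟨ψ, h1, h2, h4, fun j x hx y hy => ?_, fun L hL ⟨d, hd, hLd⟩ => ?_⟩
  · by_contra hyΩ
    have hxU : ENNReal.ofReal (mollRadius j) < infEDist x Ωᶜ := h3 j hx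
    refine absurd hxU (not_lt.2 ?_)
    refine (infEDist_le_edist_of_mem (show y ∈ Ωᶜ from hyΩ)).trans ?_
    rw [edist_dist, dist_comm]
    exact ENNReal.ofReal_le_ofReal hy
  · obtain ⟨R, hR⟩ := hL.isBounded.subset_closedBall (0 : Euc n)
    have e1 : ∀ᶠ j : ℕ in atTop, R ≤ (j : ℝ) :=
      tendsto_natCast_atTop_atTop.eventually_ge_atTop R
    have e2 : ∀ᶠ j : ℕ in atTop, mollRadius j < d / 2 :=
      tendsto_mollRadius.eventually_lt_const (by linarith)
    filter_upwards [e1, e2] with j hj1 hj2 x hx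
    refine h5 j x ⟨closedBall_subset_closedBall hj1 (hR hx), ?_⟩
    refine le_infEDist.2 fun y hy => ?_
    rw [edist_dist]
    refine ENNReal.ofReal_le_ofReal ?_
    by_contra hlt
    refine hy (hLd (mem_cthickening_of_dist_le y x _ _ hx ?_))
    rw [dist_comm]
    linarith [not_le.1 hlt]

lemma tendsto_mollify_of_continuous {w : Euc n → ℝ} (hw : Continuous w) (x : Euc n) :
    Tendsto (fun j => mollify j w x) atTop (𝓝 (w x)) := by
  rw [Metric.tendsto_nhds]
  intro ε hε
  obtain ⟨d, hd, h⟩ := Metric.continuous_iff.1 hw x (ε / 2) (half_pos hε)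
  filter_upwards [tendsto_mollRadius.eventually_lt_const hd] with j hj
  rw [Real.dist_eq, ← mollify_sub_const hw]
  refine lt_of_le_of_lt (abs_mollify_le_of_closedBall fun y hy => ?_) (half_lt_self hε)
  have := h y (lt_of_le_of_lt hy hj)
  rw [Real.dist_eq] at this
  exact this.le

lemma tendsto_integral_mollify_mul {f ζ : Euc n → ℝ} (hf : Integrable f) (hζ : Continuous ζ)
    (hc : HasCompactSupport ζ) :
    Tendsto (fun j => ∫ x, mollify j f x * ζ x) atTop (𝓝 (∫ x, f x * ζ x)) := by
  have hζi : Integrable ζ := hζ.integrable_of_hasCompactSupport hc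
  obtain ⟨C, hC⟩ := hζ.bounded_above_of_compact_support hc
  simp only [integral_mollify_mul hf hζi]
  refine tendsto_integral_of_dominated_convergence (fun x => ‖f x‖ * C) (fun j => ?_)
    (hf.norm.mul_const C) (fun j => ae_of_all _ fun x => ?_) (ae_of_all _ fun x => ?_)
  · exact hf.aestronglyMeasurable.mul
      (contDiff_mollify hζi.locallyIntegrable j 0).continuous.aestronglyMeasurable
  · rw [norm_mul]
    refine mul_le_mul_of_nonneg_left ?_ (norm_nonneg _)
    exact abs_mollify_le_of_closedBall fun y _ => hC y
  · exact (tendsto_mollify_of_continuous hζ x).const_mul (f x)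

/-- Bounded variation in the direction `v` is represented by a pair of finite measures. -/
lemma exists_measures_of_variation_bound {f : Euc n → ℝ} {Ω : Set (Euc n)} (hΩ : IsOpen Ω) {V : ℝ}
    {v : Euc n} (hf : Integrable f)
    (hV : ∀ φ : Euc n → ℝ, ContDiff ℝ 1 φ → HasCompactSupport φ → tsupport φ ⊆ Ω →
      (∀ x, |φ x| ≤ 1) → ∫ x, f x * fderiv ℝ φ x v ≤ V) :
    ∃ νp νm : Measure (Euc n), IsFiniteMeasure νp ∧ IsFiniteMeasure νm ∧
      ∀ φ : Euc n → ℝ, ContDiff ℝ 1 φ → HasCompactSupport φ → tsupport φ ⊆ Ω →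
        ∫ x, f x * fderiv ℝ φ x v = -((∫ x, φ x ∂νp) - ∫ x, φ x ∂νm) := by
  obtain ⟨ψ, hψ, hψc, hψ01, hψΩ, hψK⟩ := exists_cutoff_exhaustion (Ω := Ω)
  have hm : ∀ j, ContDiff ℝ 2 (mollify j f) := fun j => contDiff_mollify hf.locallyIntegrable j 2
  have hpc : ∀ j, Continuous fun x => fderiv ℝ (mollify j f) x v := fun j =>
    ((hm j).continuous_fderiv two_ne_zero).clm_apply continuous_const
  have hi : ∀ j, ∀ u : Euc n → ℝ, Continuous u → Integrable fun x => ψ j x * u x := fun j u hu =>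
    ((hψ j).continuous.mul hu).integrable_of_hasCompactSupport (hψc j).mul_right
  have hbd : ∀ j, ∀ u : Euc n → ℝ, Continuous u → (∀ x, u x ≤ |fderiv ℝ (mollify j f) x v|) →
      ∫ x, ψ j x * u x ≤ V := fun j u hu hle =>
    (integral_mono (hi j u hu) (hi j _ (hpc j).abs) fun x =>
      mul_le_mul_of_nonneg_left (hle x) (hψ01 j x).1).trans
      (integral_mul_abs_fderiv_mollify_le hf hV (hψ j) (hψc j) (hψ01 j) (hψΩ j))
  let qp : ℕ → Euc n → ℝ := fun j x => ψ j x * max (fderiv ℝ (mollify j f) x v) 0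
  let qm : ℕ → Euc n → ℝ := fun j x => ψ j x * max (-fderiv ℝ (mollify j f) x v) 0
  have hqp : ∀ j, Integrable (qp j) := fun j => hi j _ ((hpc j).max continuous_const)
  have hqm : ∀ j, Integrable (qm j) := fun j => hi j _ ((hpc j).neg.max continuous_const)
  let ω : Ultrafilter ℕ := Ultrafilter.of atTop
  have hω : (ω : Filter ℕ) ≤ atTop := Ultrafilter.of_le atTop
  obtain ⟨νp, hνp, hp⟩ := exists_measure_tendsto ω hqp
    (fun j x => mul_nonneg (hψ01 j x).1 (le_max_right _ _))
    (fun j => hbd j _ ((hpc j).max continuous_const) fun x => max_le (le_abs_self _) (abs_nonneg _))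
  obtain ⟨νm, hνm, hn⟩ := exists_measure_tendsto ω hqm
    (fun j x => mul_nonneg (hψ01 j x).1 (le_max_right _ _))
    (fun j => hbd j _ ((hpc j).neg.max continuous_const)
      fun x => max_le (neg_le_abs _) (abs_nonneg _))
  refine ⟨νp, νm, hνp, hνm, fun φ hφ hφc hφΩ => ?_⟩
  have hdc : Continuous fun x => fderiv ℝ φ x v :=
    (hφ.continuous_fderiv one_ne_zero).clm_apply continuous_const
  have hds : HasCompactSupport fun x => fderiv ℝ φ x v := hφc.fderiv_apply (𝕜 := ℝ) v
  have hlim := (tendsto_integral_mollify_mul hf hdc hds).mono_left hω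
  refine tendsto_nhds_unique hlim
    (((hp φ hφ.continuous hφc).sub (hn φ hφ.continuous hφc)).neg.congr' ?_)
  have hev := hψK (tsupport φ) hφc (hφc.isCompact.exists_cthickening_subset_open hΩ hφΩ)
  filter_upwards [hω hev] with j hj
  obtain ⟨C, hC⟩ := hφ.continuous.bounded_above_of_compact_support hφc
  have i1 : Integrable fun x => φ x * qp j x :=
    (hqp j).bdd_mul (c := C) hφ.continuous.aestronglyMeasurable (ae_of_all _ hC)
  have i2 : Integrable fun x => φ x * qm j x :=
    (hqm j).bdd_mul (c := C) hφ.continuous.aestronglyMeasurable (ae_of_all _ hC)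
  rw [← integral_sub i1 i2, integral_mul_fderiv_eq_neg_fderiv_mul_of_integrable
    (((hpc j).mul hφ.continuous).integrable_of_hasCompactSupport hφc.mul_left)
    (((hm j).continuous.mul hdc).integrable_of_hasCompactSupport hds.mul_left)
    (((hm j).continuous.mul hφ.continuous).integrable_of_hasCompactSupport hφc.mul_left)
    (fun x _ => (hm j).differentiable two_ne_zero x)
    (fun x _ => hφ.differentiable one_ne_zero x)]
  refine congrArg Neg.neg (integral_congr_ae (ae_of_all _ fun x => ?_))
  by_cases hx : x ∈ tsupport φ
  · simp only [qp, qm, hj x hx, one_mul]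
    rw [← mul_sub, mul_comm]
    congr 1
    rcases le_total (fderiv ℝ (mollify j f) x v) 0 with h | h
    · rw [max_eq_right h, max_eq_left (neg_nonneg.2 h)]; ring
    · rw [max_eq_left h, max_eq_right (neg_nonpos.2 h)]; ring
  · simp [image_eq_zero_of_notMem_tsupport hx]


/-- A function of bounded variation has a gradient density with respect to `volume + s`, for a
finite singular measure `s`. -/
lemma exists_isState {f f₀ : Euc n → ℝ} {Ω : Set (Euc n)} (hΩ : IsOpen Ω)
    (hv : variation n f Ω < ⊤) (hf₀ : f₀ =ᵐ[volume] Ω.indicator f) (hm : Measurable f₀)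
    (hi : Integrable f₀) :
    ∃ (s : Measure (Euc n)) (G : Euc n → Euc n), IsFiniteMeasure s ∧ s ⟂ₘ volume ∧
      IsState Ω s f₀ G ∧ ∀ x ∉ Ω, G x = 0 := by
  choose νp νm hνp hνm hν using fun i : Fin n => exists_measures_of_variation_bound hΩ
    (v := EuclideanSpace.single i 1) hi
    fun φ h1 h2 h3 h4 => integral_mul_fderiv_le_variation hΩ hv hf₀ h1 h2 h3 h4 i
  let ν : Measure (Euc n) := ∑ i, (νp i + νm i)
  have : IsFiniteMeasure ν := by
    refine ⟨?_⟩
    simp only [ν, Measure.coe_finsetSum, Finset.sum_apply, Measure.coe_add, Pi.add_apply]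
    exact ENNReal.sum_lt_top.2 fun i _ => ENNReal.add_lt_top.2
      ⟨measure_lt_top _ _, measure_lt_top _ _⟩
  let s := ν.singularPart volume
  let lam : Measure (Euc n) := volume + s
  have : IsFiniteMeasure s := inferInstanceAs (IsFiniteMeasure (ν.singularPart volume))
  have : SigmaFinite lam := inferInstanceAs (SigmaFinite (volume + s))
  have hνlam : ν ≪ lam := by
    rw [Measure.haveLebesgueDecomposition_add ν volume]
    refine Measure.AbsolutelyContinuous.add_left ?_ ?_
    · exact Measure.absolutelyContinuous_of_le (Measure.le_add_left le_rfl)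
    · exact (withDensity_absolutelyContinuous _ _).trans
        (Measure.absolutelyContinuous_of_le (Measure.le_add_right le_rfl))
  have hle : ∀ i, νp i + νm i ≤ ν := fun i =>
    Finset.single_le_sum (f := fun i => νp i + νm i) (fun i _ => Measure.zero_le _)
      (Finset.mem_univ i)
  have hpac : ∀ i, νp i ≪ lam := fun i =>
    (Measure.absolutelyContinuous_of_le ((Measure.le_add_right le_rfl).trans (hle i))).trans hνlam
  have hmac : ∀ i, νm i ≪ lam := fun i =>
    (Measure.absolutelyContinuous_of_le ((Measure.le_add_left le_rfl).trans (hle i))).trans hνlam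
  let g : Fin n → Euc n → ℝ := fun i x =>
    ((νp i).rnDeriv lam x).toReal - ((νm i).rnDeriv lam x).toReal
  have hg : ∀ i, Measurable (g i) := fun i =>
    (Measure.measurable_rnDeriv _ _).ennreal_toReal.sub
      (Measure.measurable_rnDeriv _ _).ennreal_toReal
  have hgp : ∀ i, Integrable (fun x => ((νp i).rnDeriv lam x).toReal) lam := fun i =>
    Measure.integrable_toReal_rnDeriv
  have hgm : ∀ i, Integrable (fun x => ((νm i).rnDeriv lam x).toReal) lam := fun i =>
    Measure.integrable_toReal_rnDeriv
  have hgi : ∀ i, Integrable (g i) lam := fun i => (hgp i).sub (hgm i)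
  let G₀ : Euc n → Euc n := fun x => ∑ i, g i x • EuclideanSpace.single i (1 : ℝ)
  have hG₀m : Measurable G₀ :=
    Finset.measurable_sum _ fun i _ => (hg i).smul_const _
  have hG₀i : Integrable G₀ lam := integrable_finsetSum _ fun i _ => (hgi i).smul_const _
  refine ⟨s, Ω.indicator G₀, inferInstance, Measure.mutuallySingular_singularPart _ _,
    ⟨hm, hi, hG₀m.indicator hΩ.measurableSet, hG₀i.indicator hΩ.measurableSet, ?_⟩,
    fun x hx => Set.indicator_of_notMem hx _⟩
  intro φ hφ hφc hφΩ v
  obtain ⟨C, hC⟩ := hφ.continuous.bounded_above_of_compact_support hφc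
  have hφg : ∀ u : Euc n → ℝ, Integrable u lam → Integrable (fun x => φ x * u x) lam := fun u hu =>
    hu.bdd_mul (c := C) hφ.continuous.aestronglyMeasurable (ae_of_all _ hC)
  have hinner : ∀ x, φ x * ⟪v, Ω.indicator G₀ x⟫ = ∑ i, v i * (φ x * g i x) := by
    intro x
    by_cases hx : x ∈ Ω
    · rw [Set.indicator_of_mem hx, inner_sum, Finset.mul_sum]
      refine Finset.sum_congr rfl fun i _ => ?_
      rw [inner_smul_right, EuclideanSpace.inner_single_right]
      simp; ring
    · simp [image_eq_zero_of_notMem_tsupport fun h => hx (hφΩ h)]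
  have hcoord : ∀ i, ∫ x, f₀ x * fderiv ℝ φ x (EuclideanSpace.single i 1) =
      -∫ x, φ x * g i x ∂lam := by
    intro i
    rw [hν i φ hφ hφc hφΩ, ← integral_toReal_rnDeriv_mul (hpac i),
      ← integral_toReal_rnDeriv_mul (hmac i)]
    have i1 := hφg _ (hgp i)
    have i2 := hφg _ (hgm i)
    simp only [g, mul_sub]
    rw [integral_sub i1 i2]
    simp only [mul_comm]
  have hfd : ∀ x, fderiv ℝ φ x v = ∑ i, v i * fderiv ℝ φ x (EuclideanSpace.single i 1) := by
    intro x
    conv_lhs => rw [← (EuclideanSpace.basisFun (Fin n) ℝ).sum_repr v]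
    simp
  have hfi : ∀ i, Integrable fun x => f₀ x * fderiv ℝ φ x (EuclideanSpace.single i 1) := by
    intro i
    have hdc : Continuous fun x => fderiv ℝ φ x (EuclideanSpace.single i (1 : ℝ)) :=
      (hφ.continuous_fderiv one_ne_zero).clm_apply continuous_const
    obtain ⟨D, hD⟩ := hdc.bounded_above_of_compact_support (hφc.fderiv_apply (𝕜 := ℝ) _)
    exact hi.mul_bdd (c := D) hdc.aestronglyMeasurable (ae_of_all _ hD)
  calc ∫ x, f₀ x * fderiv ℝ φ x v
      = ∫ x, ∑ i, v i * (f₀ x * fderiv ℝ φ x (EuclideanSpace.single i 1)) := by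
        refine integral_congr_ae (ae_of_all _ fun x => ?_)
        simp only [hfd, Finset.mul_sum]
        exact Finset.sum_congr rfl fun i _ => by ring
    _ = ∑ i, v i * -∫ x, φ x * g i x ∂lam := by
        rw [integral_finsetSum _ fun i _ => (hfi i).const_mul _]
        simp only [integral_const_mul, hcoord]
    _ = -∫ x, φ x * ⟪v, Ω.indicator G₀ x⟫ ∂lam := by
        simp only [hinner]
        rw [integral_finsetSum _ fun i _ => (hφg _ (hgi i)).const_mul _]
        simp only [integral_const_mul, mul_neg, Finset.sum_neg_distrib]

lemma tendsto_average_congr_ae {f f₀ : Euc n → ℝ} {Ω : Set (Euc n)} (hΩ : IsOpen Ω)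
    (h : f =ᵐ[volume.restrict Ω] f₀) {x : Euc n} (hx : x ∈ Ω) {A : ℝ → Set (Euc n)}
    (hA : ∀ r, A r ⊆ ball x r) (a : ℝ) :
    Tendsto (fun r => ⨍ y in A r, |f y - a|) (𝓝[>] 0) (𝓝 0) ↔
      Tendsto (fun r => ⨍ y in A r, |f₀ y - a|) (𝓝[>] 0) (𝓝 0) := by
  refine tendsto_congr' ?_
  obtain ⟨d, hd, hdΩ⟩ := Metric.isOpen_iff.1 hΩ x hx
  filter_upwards [Ioo_mem_nhdsGT hd] with r hr
  refine average_congr ?_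
  filter_upwards [ae_restrict_of_ae_restrict_of_subset
    ((hA r).trans ((ball_subset_ball hr.2.le).trans hdΩ)) h] with y hy
  rw [hy]

lemma sdiff_approxDiscontSet_congr_ae {f f₀ : Euc n → ℝ} {Ω : Set (Euc n)} (hΩ : IsOpen Ω)
    (h : f =ᵐ[volume.restrict Ω] f₀) : Ω \ approxDiscontSet n f = Ω \ approxDiscontSet n f₀ := by
  ext x
  refine and_congr_right fun hx => not_congr (not_congr (exists_congr fun c => ?_))
  exact tendsto_average_congr_ae hΩ h hx (fun _ => subset_rfl) c

lemma jumpSet_inter_congr_ae {f f₀ : Euc n → ℝ} {Ω : Set (Euc n)} (hΩ : IsOpen Ω)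
    (h : f =ᵐ[volume.restrict Ω] f₀) : jumpSet n f ∩ Ω = jumpSet n f₀ ∩ Ω := by
  ext x
  refine and_congr_left fun hx => exists_congr fun ν => and_congr_right fun _ =>
    exists_congr fun a => exists_congr fun b => and_congr_right fun _ => and_congr ?_ ?_
  · exact tendsto_average_congr_ae hΩ h hx (fun _ => Set.sep_subset _ _) a
  · exact tendsto_average_congr_ae hΩ h hx (fun _ => Set.sep_subset _ _) b

lemma IsVariationPair.congr_ae {f f₀ : Euc n → ℝ} {Ω : Set (Euc n)}
    (h : f =ᵐ[volume.restrict Ω] f₀) {μ : Measure (Euc n)} {σ : Euc n → Euc n}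
    (hp : IsVariationPair n f₀ Ω μ σ) : IsVariationPair n f Ω μ σ := by
  refine ⟨hp.1, hp.2.1, hp.2.2.1, hp.2.2.2.1, fun Φ h1 h2 h3 => ?_⟩
  rw [← hp.2.2.2.2 Φ h1 h2 h3]
  refine integral_congr_ae ?_
  filter_upwards [h] with x hx
  rw [hx]

end SBVApproximation

/-- One-step `SBV` approximation of a `BV` function:
there is `h ∈ SBV(Ω)` with `‖h − f‖_{L^∞(Ω)} < δ`,
`|D^j h|(Ω) ≤ |D^j f|(Ω) + 2δ` and
`|D^a h|(Ω) ≤ |D^a f|(Ω) + |D^c f|(Ω) + 3δ`. -/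
theorem BV_approximation_SBV_single
    (n : ℕ) (hn : 1 ≤ n)
    (Ω : Set (EuclideanSpace ℝ (Fin n))) (hΩ : IsOpen Ω)
    (f : EuclideanSpace ℝ (Fin n) → ℝ) (hf : IsBVOn n f Ω)
    (δ : ℝ) (hδ : 0 < δ) :
    ∃ h : EuclideanSpace ℝ (Fin n) → ℝ,
      IsSBVOn n h Ω ∧
      eLpNorm (fun x => h x - f x) ⊤ (volume.restrict Ω) < ENNReal.ofReal δ ∧
      jumpVar n h Ω ≤ jumpVar n f Ω + ENNReal.ofReal (2 * δ) ∧
      absVar n h Ω ≤ absVar n f Ω + cantorVar n f Ω + ENNReal.ofReal (3 * δ) := by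
  have hfi : Integrable (Ω.indicator f) := hf.1.integrable_indicator hΩ.measurableSet
  obtain ⟨f₀, hf₀m, hf₀⟩ := hfi.aestronglyMeasurable.aemeasurable
  have hf₀i : Integrable f₀ := hfi.congr hf₀
  obtain ⟨s, G, hsfin, hs, S, hG0⟩ := exists_isState hΩ hf.2 hf₀.symm hf₀m hf₀i
  have hff₀ : f =ᵐ[volume.restrict Ω] f₀ := by
    filter_upwards [ae_restrict_of_ae hf₀, ae_restrict_mem hΩ.measurableSet] with x hx hxΩ
    rw [← hx, Set.indicator_of_mem hxΩ]
  have hN0 : volume hs.nullSetᶜ = 0 := hs.measure_compl_nullSet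
  obtain ⟨h, H, T, hhf, habs, hjump, hcantor⟩ := S.exists_sbv hΩ hs.measurableSet_nullSet.compl hN0
    (by rw [compl_compl]; exact hs.measure_nullSet) hδ
  have hpf := (S.grad.isVariationPair hΩ S.int S.gint S.gmeas).congr_ae hff₀
  have hph := T.grad.isVariationPair hΩ T.int T.gint T.gmeas
  refine ⟨h, ⟨⟨T.int.integrableOn, T.grad.variation_lt_top T.int T.gint⟩, ?_⟩, ?_, ?_, ?_⟩
  · rw [cantorVar_eq hΩ hs T.gmeas hph, hcantor]
  · rw [eLpNorm_exponent_top]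
    refine lt_of_le_of_lt (eLpNormEssSup_le_of_ae_bound (C := δ / 2) ?_)
      ((ENNReal.ofReal_lt_ofReal_iff hδ).2 (half_lt_self hδ))
    filter_upwards [hff₀] with x hx
    rw [hx]
    exact hhf x
  · rw [jumpVar_eq hΩ hs T.gmeas hph, jumpVar_eq hΩ hs S.gmeas hpf,
      jumpSet_inter_congr_ae hΩ hff₀]
    exact hjump
  · rw [absVar_eq hΩ hs T.gmeas hph, absVar_eq hΩ hs S.gmeas hpf, cantorVar_eq hΩ hs S.gmeas hpf,
      sdiff_approxDiscontSet_congr_ae hΩ hff₀]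
    have e : ∫⁻ x, ‖G x‖ₑ = ∫⁻ x in Ω, ‖G x‖ₑ := by
      rw [← lintegral_indicator hΩ.measurableSet]
      refine lintegral_congr fun x => ?_
      by_cases hx : x ∈ Ω
      · simp [hx]
      · simp [hx, hG0 x hx]
    rw [← e]
    exact (setLIntegral_le_lintegral _ _).trans habs

end
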